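/- Let P be a Gorenstein polytope of degree d. Then P decomposes as a Cayley sum of lattice polytopes in ℝ^q for some q ≤ 2d − 1; that is, there exist q ≤ 2d − 1, s ≥ 0 with q + s = dim P, and lattice polytopes P_0, …, P_s in ℝ^q such that P is identified with P_0 * ⋯ * P_s under a ℤ-affine linear change of coordinates. -/

import Mathlib

open scoped BigOperators Pointwise

noncomputable section

/-- A point of `ℝ^m` with integer coordinates (a lattice point). -/
def IsLatticePoint {m : ℕ} (v : Fin m → ℝ) : Prop := ∀ i, ∃ z : ℤ, v i = (z : ℝ)

/-- `P` is a lattice polytope in `ℝ^m`: the convex hull of a nonempty finite set of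
lattice points. -/
def IsLatticePolytope {m : ℕ} (P : Set (Fin m → ℝ)) : Prop :=
  ∃ V : Finset (Fin m → ℝ), V.Nonempty ∧ (∀ v ∈ V, IsLatticePoint v) ∧
    P = convexHull ℝ (V : Set (Fin m → ℝ))

/-- The number of lattice points contained in a subset of `ℝ^m`. -/
def latticePointCount {m : ℕ} (A : Set (Fin m → ℝ)) : ℕ :=
  Set.ncard {z : Fin m → ℤ | (fun i => (z i : ℝ)) ∈ A}

/-- `h` is the `h^*`-polynomial of the full-dimensional lattice polytope `P ⊆ ℝ^n`:
its coefficients are nonnegative, it has degree at most `n`, and the Ehrhart counting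
function of `P` is given by `|mP ∩ ℤ^n| = ∑_i h_i * C(n + m - i, n)`, which is
equivalent to `∑_m |mP ∩ ℤ^n| t^m = h(t)/(1-t)^{n+1}`. -/
def IsHStarPoly {n : ℕ} (P : Set (Fin n → ℝ)) (h : Polynomial ℤ) : Prop :=
  h.natDegree ≤ n ∧ (∀ i, 0 ≤ h.coeff i) ∧
    ∀ m : ℕ, (latticePointCount ((m : ℝ) • P) : ℤ) =
      ∑ i ∈ Finset.range (n + 1), h.coeff i * ((n + m - i).choose n : ℤ)

/-- The normalized volume of a (full-dimensional) polytope in `ℝ^m`: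
`m!` times its Euclidean volume. -/
def normVol {m : ℕ} (P : Set (Fin m → ℝ)) : ℝ :=
  (Nat.factorial m : ℝ) * (MeasureTheory.volume P).toReal

/-- The point of `ℝ^s` over which the `j`-th summand of a Cayley sum sits:
`0` for `j = 0`, and the standard basis vector `e_j` for `j = 1, …, s`. -/
def cayleyVertex (s : ℕ) (j : Fin (s + 1)) : Fin s → ℝ :=
  fun i => if (i : ℕ) + 1 = (j : ℕ) then 1 else 0

/-- The Cayley sum `P_0 * ⋯ * P_s ⊆ ℝ^q × ℝ^s` of polytopes `P_0, …, P_s ⊆ ℝ^q`: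
the convex hull of `(P_0 × {0}) ∪ (P_1 × {e_1}) ∪ ⋯ ∪ (P_s × {e_s})`. -/
def CayleySum {q s : ℕ} (Ps : Fin (s + 1) → Set (Fin q → ℝ)) :
    Set ((Fin q → ℝ) × (Fin s → ℝ)) :=
  convexHull ℝ (⋃ j : Fin (s + 1), (fun p => (p, cayleyVertex s j)) '' Ps j)

/-- A lattice point of `ℝ^q × ℝ^s`. -/
def IsLatticePointPair {q s : ℕ} (v : (Fin q → ℝ) × (Fin s → ℝ)) : Prop :=
  IsLatticePoint v.1 ∧ IsLatticePoint v.2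

/-- An affine isomorphism `ℝ^n ≅ ℝ^q × ℝ^s` is a `ℤ`-affine linear change of coordinates
if it identifies the lattice `ℤ^n` with the lattice `ℤ^q × ℤ^s`. -/
def IsLatticeEquiv {n q s : ℕ} (T : (Fin n → ℝ) ≃ᵃ[ℝ] (Fin q → ℝ) × (Fin s → ℝ)) : Prop :=
  ∀ v : Fin n → ℝ, IsLatticePoint v ↔ IsLatticePointPair (T v)


open Filter Topology in
/-- A linear inequality system in one nonnegative unknown is solvable iff its Fourier–Motzkin
consequences hold. -/
theorem exists_nonneg_forall_mul_le_iff {α : Type*} (Y : Finset α) (f g : α → ℚ) :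
    (∃ t : ℚ, 0 ≤ t ∧ ∀ y ∈ Y, t * g y ≤ f y) ↔
      (∀ y ∈ Y, 0 ≤ g y → 0 ≤ f y) ∧
        ∀ y ∈ Y, ∀ y' ∈ Y, 0 < g y → g y' < 0 → 0 ≤ g y * f y' - g y' * f y := by
  constructor
  · rintro ⟨t, ht, h⟩
    refine ⟨fun y hy hg => (mul_nonneg ht hg).trans (h y hy), fun y hy y' hy' hg hg' => ?_⟩
    nlinarith [mul_le_mul_of_nonneg_left (h y' hy') hg.le,
      mul_le_mul_of_nonneg_left (h y hy) (neg_nonneg.2 hg'.le)]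
  · rintro ⟨h1, h2⟩
    let L : Finset ℚ := insert 0 ((Y.filter fun y => g y < 0).image fun y => f y / g y)
    have hL : L.Nonempty := ⟨0, Finset.mem_insert_self _ _⟩
    refine ⟨L.max' hL, L.le_max' _ (Finset.mem_insert_self _ _), fun y hy => ?_⟩
    rcases lt_trichotomy (g y) 0 with hg | hg | hg
    · have : f y / g y ≤ L.max' hL := L.le_max' _ <| Finset.mem_insert_of_mem <|
        Finset.mem_image_of_mem _ <| Finset.mem_filter.2 ⟨hy, hg⟩
      rwa [div_le_iff_of_neg hg] at this
    · simpa [hg] using h1 y hy hg.ge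
    · rw [← le_div_iff₀ hg]
      refine Finset.max'_le _ _ _ fun a ha => ?_
      rcases Finset.mem_insert.1 ha with rfl | ha
      · exact div_nonneg (h1 y hy hg.le) hg.le
      · obtain ⟨y', hy', rfl⟩ := Finset.mem_image.1 ha
        obtain ⟨hy', hg'⟩ := Finset.mem_filter.1 hy'
        rw [le_div_iff₀ hg, div_mul_eq_mul_div, div_le_iff_of_neg hg']
        linarith [h2 y hy y' hy' hg hg', mul_comm (g y) (f y'), mul_comm (g y') (f y)]

section Cone

variable {ι E : Type*} [AddCommGroup E] [Module ℚ E]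

/-- The cone of nonnegative rational combinations of the vectors `v i`, `i ∈ s`. -/
def ratCone (v : ι → E) (s : Finset ι) : Set E :=
  {p | ∃ l : ι → ℚ, (∀ i ∈ s, 0 ≤ l i) ∧ ∑ i ∈ s, l i • v i = p}

theorem mem_ratCone_insert [DecidableEq ι] (v : ι → E) {s : Finset ι} {a : ι} (ha : a ∉ s)
    (p : E) : p ∈ ratCone v (insert a s) ↔ ∃ t : ℚ, 0 ≤ t ∧ p - t • v a ∈ ratCone v s := by
  constructor
  · rintro ⟨l, hl, rfl⟩
    refine ⟨l a, hl a (Finset.mem_insert_self _ _), l,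
      fun i hi => hl i (Finset.mem_insert_of_mem hi), ?_⟩
    rw [Finset.sum_insert ha]; abel
  · rintro ⟨t, ht, l, hl, h⟩
    have key : ∀ i ∈ s, Function.update l a t i = l i := fun i hi =>
      Function.update_of_ne (by rintro rfl; exact ha hi) _ _
    refine ⟨Function.update l a t, fun i hi => ?_, ?_⟩
    · rcases Finset.mem_insert.1 hi with rfl | hi
      · simpa
      · rw [key i hi]; exact hl i hi
    · rw [Finset.sum_insert ha, Function.update_self,
        Finset.sum_congr rfl fun i hi => by rw [key i hi], h]
      abel

/-- **Minkowski–Weyl**: a finitely generated rational cone is an intersection of finitely many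
half-spaces. -/
theorem exists_halfspaces_ratCone [FiniteDimensional ℚ E] (v : ι → E) (s : Finset ι) :
    ∃ Y : Finset (Module.Dual ℚ E), ∀ p, p ∈ ratCone v s ↔ ∀ y ∈ Y, 0 ≤ y p := by
  classical
  induction s using Finset.induction_on with
  | empty =>
    let b := Module.finBasis ℚ E
    refine ⟨Finset.univ.image b.coord ∪ Finset.univ.image (fun i => -b.coord i), fun p => ?_⟩
    have : p ∈ ratCone v ∅ ↔ p = 0 := by simp [ratCone, eq_comm]
    rw [this]
    refine ⟨by rintro rfl; simp, fun h => ?_⟩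
    refine b.ext_elem fun i => ?_
    have h1 := h (b.coord i) (by simp)
    have h2 := h (-b.coord i) (by simp)
    simp only [LinearMap.neg_apply, Module.Basis.coord_apply] at h1 h2
    simpa using le_antisymm (by linarith) h1
  | insert a s ha ih =>
    obtain ⟨Y, hY⟩ := ih
    refine ⟨(Y.filter fun y => 0 ≤ y (v a)) ∪
      ((Y ×ˢ Y).filter fun z => 0 < z.1 (v a) ∧ z.2 (v a) < 0).image
        (fun z => z.1 (v a) • z.2 - z.2 (v a) • z.1), fun p => ?_⟩
    have h1 : p ∈ ratCone v (insert a s) ↔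
        ∃ t : ℚ, 0 ≤ t ∧ ∀ y ∈ Y, t * y (v a) ≤ y p := by
      rw [mem_ratCone_insert v ha]
      simp only [hY, map_sub, map_smul, smul_eq_mul, sub_nonneg]
    rw [h1, exists_nonneg_forall_mul_le_iff Y (fun y => y p) (fun y => y (v a))]
    constructor
    · rintro ⟨h2, h3⟩ y hy
      rcases Finset.mem_union.1 hy with hy | hy
      · obtain ⟨hy, hy'⟩ := Finset.mem_filter.1 hy
        exact h2 y hy hy'
      · obtain ⟨z, hz, rfl⟩ := Finset.mem_image.1 hy
        obtain ⟨hz, hz1, hz2⟩ := Finset.mem_filter.1 hz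
        obtain ⟨hza, hzb⟩ := Finset.mem_product.1 hz
        simpa using h3 z.1 hza z.2 hzb hz1 hz2
    · intro h
      refine ⟨fun y hy hy' => h y (Finset.mem_union_left _ (Finset.mem_filter.2 ⟨hy, hy'⟩)),
        fun y hy y' hy' hg hg' => ?_⟩
      have := h (y (v a) • y' - y' (v a) • y) (Finset.mem_union_right _ (Finset.mem_image.2
        ⟨(y, y'), Finset.mem_filter.2 ⟨Finset.mem_product.2 ⟨hy, hy'⟩, hg, hg'⟩, rfl⟩))
      simpa using this

/-- **Farkas' lemma** over the rationals. -/
theorem mem_ratCone_of_forall_nonneg [FiniteDimensional ℚ E] (Y : Finset (Module.Dual ℚ E))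
    (u : Module.Dual ℚ E) (hu : ∀ p, (∀ y ∈ Y, 0 ≤ y p) → 0 ≤ u p) : u ∈ ratCone id Y := by
  classical
  obtain ⟨Z, hZ⟩ := exists_halfspaces_ratCone (id : Module.Dual ℚ E → _) Y
  rw [hZ]
  intro z hz
  obtain ⟨p, rfl⟩ := (Module.evalEquiv ℚ E).surjective z
  simp only [Module.evalEquiv_apply, Module.Dual.eval_apply]
  refine hu p fun y hy => ?_
  have : y ∈ ratCone (id : Module.Dual ℚ E → _) Y :=
    ⟨Pi.single y 1, fun i _ => by
      by_cases h : i = y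
      · subst h; simp
      · simp [h], by simp [Pi.single_apply, hy]⟩
  simpa using (hZ y).1 this _ hz

/-- **Carathéodory's theorem** for cones. -/
theorem exists_linearIndepOn_of_mem_ratCone (v : ι → E) (s : Finset ι) {p : E}
    (hp : p ∈ ratCone v s) : ∃ s' ⊆ s, LinearIndepOn ℚ v (s' : Set ι) ∧
      ∃ l : ι → ℚ, (∀ i ∈ s', 0 < l i) ∧ ∑ i ∈ s', l i • v i = p := by
  classical
  induction s using Finset.strongInduction with
  | H s ih =>
    obtain ⟨l, hl, rfl⟩ := hp
    by_cases hpos : ∀ i ∈ s, 0 < l i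
    · by_cases hli : LinearIndepOn ℚ v (s : Set ι)
      · exact ⟨s, subset_rfl, hli, l, hpos, rfl⟩
      · obtain ⟨g, hg0, i, hi, hgi⟩ : ∃ g : ι → ℚ, ∑ i ∈ s, g i • v i = 0 ∧ ∃ i ∈ s, 0 < g i := by
          rw [linearIndepOn_finset_iff] at hli
          push Not at hli
          obtain ⟨g, hg0, i, hi, hgi⟩ := hli
          rcases lt_or_gt_of_ne hgi with h | h
          · exact ⟨-g, by simp [hg0], i, hi, by simpa⟩
          · exact ⟨g, hg0, i, hi, h⟩
        obtain ⟨j, hj, hmin⟩ := (s.filter fun i => 0 < g i).exists_min_image (fun i => l i / g i)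
          ⟨i, Finset.mem_filter.2 ⟨hi, hgi⟩⟩
        obtain ⟨hjs, hgj⟩ := Finset.mem_filter.1 hj
        set t := l j / g j with ht
        have ht0 : 0 ≤ t := div_nonneg (hl j hjs) hgj.le
        have key : ∑ i ∈ s.erase j, (l i - t * g i) • v i = ∑ i ∈ s, l i • v i := by
          have hj0 : l j - t * g j = 0 := by rw [ht]; field_simp; ring
          have : ∑ i ∈ s, (l i - t * g i) • v i = ∑ i ∈ s, l i • v i := by
            simp only [sub_smul, mul_smul, Finset.sum_sub_distrib, ← Finset.smul_sum, hg0,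
              smul_zero, sub_zero]
          rw [← this, ← Finset.add_sum_erase s _ hjs, hj0, zero_smul, zero_add]
        have hnonneg : ∀ i ∈ s.erase j, 0 ≤ l i - t * g i := by
          intro i hi
          have his := Finset.mem_of_mem_erase hi
          rcases lt_or_ge 0 (g i) with h | h
          · have := hmin i (Finset.mem_filter.2 ⟨his, h⟩)
            rw [le_div_iff₀ h] at this
            linarith
          · nlinarith [hl i his, mul_nonneg ht0 (neg_nonneg.2 h)]
        obtain ⟨s', hs', h⟩ := ih (s.erase j) (Finset.erase_ssubset hjs)
          ⟨fun i => l i - t * g i, hnonneg, key⟩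
        exact ⟨s', hs'.trans (Finset.erase_subset _ _), h⟩
    · push Not at hpos
      obtain ⟨j, hj, hlj⟩ := hpos
      have hj0 : l j = 0 := le_antisymm hlj (hl j hj)
      have key : ∑ i ∈ s.erase j, l i • v i = ∑ i ∈ s, l i • v i := by
        rw [← Finset.add_sum_erase s _ hj, hj0, zero_smul, zero_add]
      obtain ⟨s', hs', h⟩ := ih (s.erase j) (Finset.erase_ssubset hj)
        ⟨l, fun i hi => hl i (Finset.mem_of_mem_erase hi), key⟩
      exact ⟨s', hs'.trans (Finset.erase_subset _ _), h⟩

end Cone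

section Generic

open Filter Topology

/-- `a + ε b` is positive for all sufficiently small `ε > 0`. -/
def PosAt (a b : ℚ) : Prop := 0 < a ∨ (a = 0 ∧ 0 < b)

theorem PosAt.eventually {a b : ℚ} (h : PosAt a b) : ∀ᶠ ε in 𝓝[>] (0 : ℚ), 0 < a + ε * b := by
  rcases h with h | ⟨rfl, h⟩
  · have hc : Tendsto (fun ε : ℚ => a + ε * b) (𝓝[>] 0) (𝓝 (a + 0 * b)) :=
      ((by fun_prop : Continuous fun ε : ℚ => a + ε * b).tendsto 0).mono_left nhdsWithin_le_nhds
    exact hc.eventually (lt_mem_nhds (by simpa using h))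
  · filter_upwards [self_mem_nhdsWithin] with ε hε
    have : 0 < ε := hε
    positivity

theorem eventually_neg_of_not_posAt {a b : ℚ} (hb : b ≠ 0) (h : ¬PosAt a b) :
    ∀ᶠ ε in 𝓝[>] (0 : ℚ), a + ε * b < 0 := by
  have h' : PosAt (-a) (-b) := by
    unfold PosAt at *
    grind
  filter_upwards [h'.eventually] with ε hε
  linarith

theorem eventually_add_mul_ne_zero {a b : ℚ} (h : a ≠ 0 ∨ b ≠ 0) :
    ∀ᶠ ε in 𝓝[>] (0 : ℚ), a + ε * b ≠ 0 := by
  by_cases hp : PosAt a b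
  · exact hp.eventually.mono fun _ h => h.ne'
  · have h' : PosAt (-a) (-b) := by
      unfold PosAt at *
      grind
    filter_upwards [h'.eventually] with ε hε h0
    linarith

theorem exists_pos_forall_sum_mul_ne_zero {ι : Type*} [Fintype ι] (G : Finset (ι → ℚ))
    (hG : ∀ g ∈ G, g ≠ 0) : ∃ c : ι → ℚ, (∀ i, 0 < c i) ∧ ∀ g ∈ G, ∑ i, c i * g i ≠ 0 := by
  classical
  induction G using Finset.induction_on with
  | empty => exact ⟨fun _ => 1, by simp, by simp⟩
  | insert g G hg ih =>
    obtain ⟨c, hc, hcG⟩ := ih fun g hg => hG g (Finset.mem_insert_of_mem hg)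
    obtain ⟨i, hi⟩ := Function.ne_iff.1 (hG g (Finset.mem_insert_self _ _))
    have hsum : ∀ (ε : ℚ) (f : ι → ℚ), ∑ j, (c j + ε * (Pi.single i 1 : ι → ℚ) j) * f j =
        (∑ j, c j * f j) + ε * f i := by
      intro ε f
      simp [add_mul, Finset.sum_add_distrib, Pi.single_apply]
    have h1 : ∀ᶠ ε in 𝓝[>] (0 : ℚ), ∀ f ∈ G, (∑ j, c j * f j) + ε * f i ≠ 0 :=
      (Finset.eventually_all G).2 fun f hf => eventually_add_mul_ne_zero (Or.inl (hcG f hf))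
    obtain ⟨ε, h1, h2, hε⟩ := (h1.and ((eventually_add_mul_ne_zero
      (a := ∑ j, c j * g j) (Or.inr hi)).and self_mem_nhdsWithin)).exists
    have hε : 0 < ε := hε
    refine ⟨fun j => c j + ε * (Pi.single i 1 : ι → ℚ) j, fun j => ?_, fun f hf => ?_⟩
    · have : 0 ≤ (Pi.single i 1 : ι → ℚ) j := by
        by_cases h : j = i
        · subst h; simp
        · simp [h]
      have := hc j
      positivity
    · rw [hsum]
      rcases Finset.mem_insert.1 hf with rfl | hf
      · exact h2
      · exact h1 f hf

variable {ι E : Type*} [AddCommGroup E] [Module ℚ E]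

/-- `w` lies in no subspace spanned by fewer than `dim E` of the vectors `v i`. -/
def IsGenericFor (v : ι → E) (w : E) : Prop :=
  ∀ s : Finset ι, s.card < Module.finrank ℚ E → w ∉ Submodule.span ℚ (v '' s)

theorem IsGenericFor.neg {v : ι → E} {w : E} (h : IsGenericFor v w) : IsGenericFor v (-w) :=
  fun s hs hw => h s hs (by simpa using Submodule.neg_mem _ hw)

theorem IsGenericFor.eventually [Finite ι] {v : ι → E} {w : E} (h : IsGenericFor v w) (p : E) :
    ∀ᶠ ε in 𝓝[>] (0 : ℚ), IsGenericFor v (p + ε • w) := by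
  refine eventually_all.2 fun s => ?_
  by_cases hs : s.card < Module.finrank ℚ E
  swap
  · exact Eventually.of_forall fun _ h => absurd h hs
  obtain ⟨f, hfw, hf⟩ := Submodule.exists_le_ker_of_notMem (h s hs)
  filter_upwards [eventually_add_mul_ne_zero (a := f p) (Or.inr hfw)] with ε hε _ hmem
  exact hε (by simpa using hf hmem)

theorem exists_isGenericFor [Fintype ι] [FiniteDimensional ℚ E] {v : ι → E}
    (hv : Submodule.span ℚ (Set.range v) = ⊤) (Y : Finset (Module.Dual ℚ E)) (hY : ∀ y ∈ Y, y ≠ 0) :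
    ∃ w ∈ ratCone v Finset.univ, IsGenericFor v w ∧ ∀ y ∈ Y, y w ≠ 0 := by
  classical
  have hne : ∀ f : Module.Dual ℚ E, f ≠ 0 → (fun i => f (v i)) ≠ 0 := by
    intro f hf h
    exact hf (LinearMap.ext_on_range hv fun i => by simpa using congrFun h i)
  have hex : ∀ s : Finset ι, ∃ f : Module.Dual ℚ E, s.card < Module.finrank ℚ E →
      f ≠ 0 ∧ Submodule.span ℚ (v '' s) ≤ LinearMap.ker f := by
    intro s
    by_cases hs : s.card < Module.finrank ℚ E
    · have hlt : Submodule.span ℚ (v '' s) < ⊤ := by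
        refine lt_top_iff_ne_top.2 fun h => ?_
        have h1 := finrank_span_finset_le_card (R := ℚ) (s.image v)
        rw [Finset.coe_image, Set.finrank, h, finrank_top] at h1
        exact absurd (h1.trans Finset.card_image_le) (not_le.2 hs)
      obtain ⟨f, hf, hf'⟩ := Submodule.exists_le_ker_of_lt_top _ hlt
      exact ⟨f, fun _ => ⟨hf, hf'⟩⟩
    · exact ⟨0, fun h => absurd h hs⟩
  choose f hf using hex
  obtain ⟨c, hc, hcG⟩ := exists_pos_forall_sum_mul_ne_zero
    ((Y.image fun y i => y (v i)) ∪ ((Finset.univ.filter fun s : Finset ι =>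
      s.card < Module.finrank ℚ E).image fun s i => f s (v i))) (by
    intro g hg
    rcases Finset.mem_union.1 hg with hg | hg
    · obtain ⟨y, hy, rfl⟩ := Finset.mem_image.1 hg
      exact hne y (hY y hy)
    · obtain ⟨s, hs, rfl⟩ := Finset.mem_image.1 hg
      exact hne _ (hf s (Finset.mem_filter.1 hs).2).1)
  have hsum : ∀ y : Module.Dual ℚ E, y (∑ i, c i • v i) = ∑ i, c i * y (v i) := fun y => by simp
  refine ⟨∑ i, c i • v i, ⟨c, fun i _ => (hc i).le, rfl⟩, fun s hs hw => ?_, fun y hy => ?_⟩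
  · have h1 := (hf s hs).2 hw
    rw [LinearMap.mem_ker, hsum] at h1
    exact hcG _ (Finset.mem_union_right _ (Finset.mem_image_of_mem _
      (Finset.mem_filter.2 ⟨Finset.mem_univ _, hs⟩))) h1
  · rw [hsum]
    exact hcG _ (Finset.mem_union_left _ (Finset.mem_image_of_mem _ hy))

end Generic

section Triangulation

open Filter Topology

universe u

variable {ι : Type u} {E : Type*} [AddCommGroup E] [Module ℚ E]

/-- `B` indexes a basis among the vectors `v i`. -/
def IsBasisSet (v : ι → E) (B : Finset ι) : Prop :=
  LinearIndepOn ℚ v (B : Set ι) ∧ B.card = Module.finrank ℚ E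

theorem IsBasisSet.exists_basis [FiniteDimensional ℚ E] {v : ι → E} {B : Finset ι}
    (h : IsBasisSet v B) : ∃ b : Module.Basis B ℚ E, ∀ i, b i = v i := by
  have hli : LinearIndependent ℚ (fun i : B => v i) := h.1
  have hsp := hli.span_eq_top_of_card_eq_finrank' (by simpa using h.2)
  exact ⟨Module.Basis.mk hli hsp.ge, fun i => by simp⟩

theorem IsBasisSet.exists_sum [FiniteDimensional ℚ E] {v : ι → E} {B : Finset ι}
    (h : IsBasisSet v B) (p : E) : ∃ a : ι → ℚ, ∑ i ∈ B, a i • v i = p := by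
  classical
  obtain ⟨b, hb⟩ := h.exists_basis
  refine ⟨fun i => if hi : i ∈ B then b.repr p ⟨i, hi⟩ else 0, ?_⟩
  rw [← Finset.sum_coe_sort]
  conv_rhs => rw [← b.sum_repr p]
  exact Finset.sum_congr rfl fun i _ => by simp [hb]

theorem IsBasisSet.exists_dual [FiniteDimensional ℚ E] {v : ι → E} {B : Finset ι}
    (h : IsBasisSet v B) (c : ι → ℚ) : ∃ y : Module.Dual ℚ E, ∀ i ∈ B, y (v i) = c i := by
  obtain ⟨b, hb⟩ := h.exists_basis
  refine ⟨b.constr ℚ fun i => c i, fun i hi => ?_⟩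
  rw [← hb ⟨i, hi⟩, Module.Basis.constr_basis]

/-- No basis among the lifted vectors `(v i, c i)` spans a hyperplane through a further one. -/
def IsGenericHeight (v : ι → E) (c : ι → ℚ) : Prop :=
  ∀ B, IsBasisSet v B → ∀ y : Module.Dual ℚ E, (∀ i ∈ B, y (v i) = c i) →
    ∀ j ∉ B, y (v j) ≠ c j

theorem exists_isGenericHeight [Fintype ι] [FiniteDimensional ℚ E] (v : ι → E) :
    ∃ c, IsGenericHeight v c := by
  classical
  have hex : ∀ (B : Finset ι) (j : ι), ∃ a : ι → ℚ, IsBasisSet v B →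
      ∑ i ∈ B, a i • v i = v j := by
    intro B j
    by_cases hB : IsBasisSet v B
    · obtain ⟨a, ha⟩ := hB.exists_sum (v j)
      exact ⟨a, fun _ => ha⟩
    · exact ⟨0, fun h => absurd h hB⟩
  choose a ha using hex
  let g : Finset ι × ι → ι → ℚ := fun x i =>
    (Pi.single x.2 1 : ι → ℚ) i - if i ∈ x.1 then a x.1 x.2 i else 0
  obtain ⟨c, -, hc⟩ := exists_pos_forall_sum_mul_ne_zero
    ((Finset.univ.filter fun x : Finset ι × ι => x.2 ∉ x.1).image g) (by
    intro f hf
    obtain ⟨x, hx, rfl⟩ := Finset.mem_image.1 hf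
    intro h0
    have := congrFun h0 x.2
    simp [g, (Finset.mem_filter.1 hx).2] at this)
  refine ⟨c, fun B hB y hy j hj h => ?_⟩
  refine hc _ (Finset.mem_image_of_mem g (Finset.mem_filter.2
    ⟨Finset.mem_univ (B, j), hj⟩)) ?_
  have h1 : y (v j) = ∑ i ∈ B, a B j i * c i := by
    rw [← ha B j hB, map_sum]
    exact Finset.sum_congr rfl fun i hi => by simp [hy i hi]
  simp only [g, mul_sub, Finset.sum_sub_distrib, mul_ite, mul_zero, Finset.sum_ite_mem,
    Finset.univ_inter]
  rw [Finset.sum_congr rfl fun i _ => mul_comm (c i) (a B j i), ← h1, h]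
  simp [Pi.single_apply]

/-- `B` is a cell of the regular triangulation induced by the heights `c`. -/
def IsRegularCell (v : ι → E) (c : ι → ℚ) (B : Finset ι) : Prop :=
  IsBasisSet v B ∧ ∃ y : Module.Dual ℚ E, (∀ i ∈ B, y (v i) = c i) ∧ ∀ i ∉ B, y (v i) < c i

theorem IsGenericFor.pos {v : ι → E} {p : E} (hp : IsGenericFor v p) {B : Finset ι}
    (hB : B.card ≤ Module.finrank ℚ E) {l : ι → ℚ} (h : ∑ i ∈ B, l i • v i = p) :
    ∀ i ∈ B, l i ≠ 0 := by
  classical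
  intro i hi h0
  refine hp (B.erase i) ((Finset.card_erase_lt_of_mem hi).trans_le hB) ?_
  rw [← h, ← Finset.add_sum_erase B _ hi, h0, zero_smul, zero_add]
  exact Submodule.sum_mem _ fun j hj => Submodule.smul_mem _ _ <|
    Submodule.subset_span (Set.mem_image_of_mem _ hj)

theorem IsGenericFor.isBasisSet [FiniteDimensional ℚ E] {v : ι → E} {p : E}
    (hp : IsGenericFor v p) {s : Finset ι} (hs : p ∈ ratCone v s) :
    ∃ B ⊆ s, IsBasisSet v B ∧ p ∈ ratCone v B := by
  obtain ⟨B, hBs, hli, l, hl, hsum⟩ := exists_linearIndepOn_of_mem_ratCone v s hs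
  refine ⟨B, hBs, ⟨hli, le_antisymm ?_ ?_⟩, l, fun i hi => (hl i hi).le, hsum⟩
  · simpa using LinearIndependent.fintype_card_le_finrank (R := ℚ) (b := fun i : B => v i) hli
  · by_contra! hlt
    refine hp B hlt ?_
    rw [← hsum]
    exact Submodule.sum_mem _ fun j hj => Submodule.smul_mem _ _ <|
      Submodule.subset_span (Set.mem_image_of_mem _ hj)

theorem sum_insert_erase_smul [DecidableEq ι] {B : Finset ι} {j k : ι} (hj : j ∉ B) (hk : k ∈ B)
    {l a l' : ι → ℚ} {t : ℚ} (hk0 : l k - t * a k = 0) (hl'j : l' j = t)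
    (hl' : ∀ i ∈ B, l' i = l i - t * a i) (f : ι → E) :
    ∑ i ∈ insert j (B.erase k), l' i • f i =
      t • f j + (∑ i ∈ B, l i • f i - t • ∑ i ∈ B, a i • f i) := by
  rw [Finset.sum_insert fun h => hj (Finset.mem_of_mem_erase h), hl'j,
    Finset.sum_congr rfl fun i hi => by rw [hl' i (Finset.mem_of_mem_erase hi)]]
  have : ∑ i ∈ B.erase k, (l i - t * a i) • f i = ∑ i ∈ B, (l i - t * a i) • f i := by
    rw [← Finset.add_sum_erase B _ hk, hk0, zero_smul, zero_add]
  rw [this]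
  simp only [sub_smul, mul_smul, Finset.sum_sub_distrib, ← Finset.smul_sum]

theorem exists_isRegularCell [Fintype ι] [FiniteDimensional ℚ E] {v : ι → E}
    {u : Module.Dual ℚ E} (hu : ∀ i, u (v i) = 1) {c : ι → ℚ} (hc : IsGenericHeight v c) {p : E}
    (hp : p ∈ ratCone v Finset.univ) (hgen : IsGenericFor v p) :
    ∃ B, IsRegularCell v c B ∧ p ∈ ratCone v B := by
  classical
  have hex : ∀ B : Finset ι, ∃ y : Module.Dual ℚ E, IsBasisSet v B →
      ∀ i ∈ B, y (v i) = c i := by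
    intro B
    by_cases hB : IsBasisSet v B
    · obtain ⟨y, hy⟩ := hB.exists_dual c
      exact ⟨y, fun _ => hy⟩
    · exact ⟨0, fun h => absurd h hB⟩
  choose y hy using hex
  obtain ⟨B₀, -, hB₀⟩ := hgen.isBasisSet hp
  obtain ⟨B, ⟨hB, l, hl, hlp⟩, hmin⟩ :=
    Set.exists_min_image {B | IsBasisSet v B ∧ p ∈ ratCone v B} (fun B => y B p)
      (Set.toFinite _) ⟨B₀, hB₀⟩
  refine ⟨B, ⟨hB, y B, hy B hB, fun j hj => ?_⟩, l, hl, hlp⟩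
  by_contra! hle
  have hlt : c j < y B (v j) := lt_of_le_of_ne hle (hc B hB _ (hy B hB) j hj).symm
  have hlpos : ∀ i ∈ B, 0 < l i := fun i hi =>
    lt_of_le_of_ne (hl i hi) (hgen.pos hB.2.le hlp i hi).symm
  obtain ⟨a, ha⟩ := hB.exists_sum (v j)
  have hsum : ∑ i ∈ B, a i = 1 := by
    have := congrArg u ha
    simpa [hu] using this
  obtain ⟨i₁, hi₁, hai₁⟩ : ∃ i ∈ B, 0 < a i := by
    by_contra! h
    linarith [Finset.sum_nonpos h]
  obtain ⟨k, hk, hkmin⟩ := (B.filter fun i => 0 < a i).exists_min_image (fun i => l i / a i)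
    ⟨i₁, Finset.mem_filter.2 ⟨hi₁, hai₁⟩⟩
  obtain ⟨hkB, hak⟩ := Finset.mem_filter.1 hk
  set t := l k / a k with ht
  have ht0 : 0 < t := div_pos (hlpos k hkB) hak
  have hk0 : l k - t * a k = 0 := by rw [ht]; field_simp; ring
  have hnonneg : ∀ i ∈ B, 0 ≤ l i - t * a i := by
    intro i hi
    rcases lt_or_ge 0 (a i) with h | h
    · have := hkmin i (Finset.mem_filter.2 ⟨hi, h⟩)
      rw [le_div_iff₀ h] at this
      linarith
    · nlinarith [hl i hi, mul_nonneg ht0.le (neg_nonneg.2 h)]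
  have hjk : j ∉ B.erase k := fun h => hj (Finset.mem_of_mem_erase h)
  let l' : ι → ℚ := fun i => if i = j then t else l i - t * a i
  have hl'j : l' j = t := by simp [l']
  have hl' : ∀ i ∈ B, l' i = l i - t * a i := by
    intro i hi
    have : i ≠ j := by rintro rfl; exact hj hi
    simp [l', this]
  have hl'p : ∑ i ∈ insert j (B.erase k), l' i • v i = p := by
    rw [sum_insert_erase_smul hj hkB hk0 hl'j hl' v, hlp, ha]; abel
  have hp' : p ∈ ratCone v (insert j (B.erase k)) := by
    refine ⟨l', fun i hi => ?_, hl'p⟩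
    rcases Finset.mem_insert.1 hi with rfl | hi
    · rw [hl'j]; exact ht0.le
    · have := Finset.mem_of_mem_erase hi
      rw [hl' i this]; exact hnonneg i this
  obtain ⟨B', hB's, hB', hpB'⟩ := hgen.isBasisSet hp'
  have hcard : (insert j (B.erase k)).card = B.card := by
    rw [Finset.card_insert_of_notMem hjk, Finset.card_erase_add_one hkB]
  obtain rfl : B' = insert j (B.erase k) :=
    Finset.eq_of_subset_of_card_le hB's (by rw [hcard, hB.2, hB'.2])
  have hcost := hmin _ ⟨hB', hpB'⟩
  have h1 : y (insert j (B.erase k)) p = ∑ i ∈ insert j (B.erase k), l' i • c i := by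
    conv_lhs => rw [← hl'p]
    rw [map_sum]
    exact Finset.sum_congr rfl fun i hi => by rw [map_smul, hy _ hB' i hi]
  have h2 : y B p = ∑ i ∈ B, l i • c i := by
    conv_lhs => rw [← hlp]
    rw [map_sum]
    exact Finset.sum_congr rfl fun i hi => by rw [map_smul, hy _ hB i hi]
  have h3 : y B (v j) = ∑ i ∈ B, a i • c i := by
    conv_lhs => rw [← ha]
    rw [map_sum]
    exact Finset.sum_congr rfl fun i hi => by rw [map_smul, hy _ hB i hi]
  rw [h1, sum_insert_erase_smul hj hkB hk0 hl'j hl' c, ← h2, ← h3, smul_eq_mul, smul_eq_mul] at hcost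
  nlinarith

theorem IsRegularCell.subset {v : ι → E} {c : ι → ℚ} {B B' : Finset ι}
    (hB : IsRegularCell v c B) (hB' : IsRegularCell v c B') {l l' : ι → ℚ}
    (hl : ∀ i ∈ B, 0 < l i) (hl' : ∀ i ∈ B', 0 < l' i)
    (h : ∑ i ∈ B, l i • v i = ∑ i ∈ B', l' i • v i) : B' ⊆ B := by
  obtain ⟨-, y, hy, hylt⟩ := hB
  obtain ⟨-, y', hy', hylt'⟩ := hB'
  have e1 : ∀ (z : Module.Dual ℚ E) (s : Finset ι) (m : ι → ℚ),
      z (∑ i ∈ s, m i • v i) = ∑ i ∈ s, m i * z (v i) := fun z s m => by simp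
  have hle : ∀ i, y (v i) ≤ c i := fun i => by
    by_cases hi : i ∈ B
    · exact (hy i hi).le
    · exact (hylt i hi).le
  have hle' : ∀ i, y' (v i) ≤ c i := fun i => by
    by_cases hi : i ∈ B'
    · exact (hy' i hi).le
    · exact (hylt' i hi).le
  have h1 : ∑ i ∈ B, l i * c i = ∑ i ∈ B', l' i * y (v i) := by
    rw [← e1, ← h, e1]; exact Finset.sum_congr rfl fun i hi => by rw [hy i hi]
  have h2 : ∑ i ∈ B', l' i * c i = ∑ i ∈ B, l i * y' (v i) := by
    rw [← e1, h, e1]; exact Finset.sum_congr rfl fun i hi => by rw [hy' i hi]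
  have h3 : ∑ i ∈ B, l i * y' (v i) ≤ ∑ i ∈ B, l i * c i :=
    Finset.sum_le_sum fun i hi => mul_le_mul_of_nonneg_left (hle' i) (hl i hi).le
  have h4 : ∑ i ∈ B', l' i * (c i - y (v i)) ≤ 0 := by
    simp only [mul_sub, Finset.sum_sub_distrib]; linarith
  intro i hi
  by_contra hiB
  have h5 : 0 < ∑ i ∈ B', l' i * (c i - y (v i)) :=
    Finset.sum_pos' (fun j hj => mul_nonneg (hl' j hj).le (sub_nonneg.2 (hle j)))
      ⟨i, hi, mul_pos (hl' i hi) (sub_pos.2 (hylt i hiB))⟩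
  linarith

theorem IsBasisSet.exists_basis_fin [FiniteDimensional ℚ E] {v : ι → E} {B : Finset ι}
    (h : IsBasisSet v B) : ∃ (b : Module.Basis (Fin (Module.finrank ℚ E)) ℚ E)
      (e : Fin (Module.finrank ℚ E) ≃ B), (∀ i, b i = v (e i)) ∧
        ∀ l : ι → ℚ, ∀ i, b.repr (∑ j ∈ B, l j • v j) i = l (e i) := by
  obtain ⟨b, hb⟩ := h.exists_basis
  let e := B.equivFinOfCardEq h.2
  refine ⟨b.reindex e, e.symm, fun i => by simp [hb], fun l i => ?_⟩
  have : ∑ j ∈ B, l j • v j = ∑ j, l (e.symm j) • (b.reindex e) j := by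
    rw [← Finset.sum_coe_sort, ← Equiv.sum_comp e.symm]
    simp [hb]
  rw [this, Module.Basis.repr_sum_self]

/-- A cone generated by vectors at height one has a simplicial subdivision without new rays.
Moreover, perturbing in a generic direction `w` assigns every point to a unique cell. -/
theorem exists_triangulation [Fintype ι] [FiniteDimensional ℚ E] (v : ι → E)
    {u : Module.Dual ℚ E} (hu : ∀ i, u (v i) = 1) :
    ∃ (τ : Type u) (_ : Fintype τ) (b : τ → Module.Basis (Fin (Module.finrank ℚ E)) ℚ E),
      (∀ t i, ∃ j, b t i = v j) ∧ ∀ w, IsGenericFor v w →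
        (∀ t i, (b t).repr w i ≠ 0) ∧
        ∀ p, (∀ᶠ ε in 𝓝[>] (0 : ℚ), p + ε • w ∈ ratCone v Finset.univ) →
          ∃! t, ∀ i, PosAt ((b t).repr p i) ((b t).repr w i) := by
  classical
  obtain ⟨c, hc⟩ := exists_isGenericHeight v
  have hB : ∀ t : {B // IsRegularCell v c B}, IsBasisSet v t.1 := fun t => t.2.1
  choose b e hbe hrepr using fun t => (hB t).exists_basis_fin
  have hne : ∀ w, IsGenericFor v w → ∀ t i, (b t).repr w i ≠ 0 := by
    intro w hw t i
    obtain ⟨l, hl⟩ := (hB t).exists_sum w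
    have := hw.pos (hB t).2.le hl (e t i) (e t i).2
    rwa [← hl, hrepr]
  refine ⟨{B // IsRegularCell v c B}, inferInstance, b, fun t i => ⟨_, hbe t i⟩,
    fun w hw => ⟨hne w hw, fun p hp => ?_⟩⟩
  have hadd : ∀ t (ε : ℚ) i,
      (b t).repr (p + ε • w) i = (b t).repr p i + ε * (b t).repr w i := by simp
  refine existsUnique_of_exists_of_unique ?_ ?_
  · by_contra! hno
    have hneg : ∀ᶠ ε in 𝓝[>] (0 : ℚ), ∀ t, ∃ i, (b t).repr (p + ε • w) i < 0 := by
      refine eventually_all.2 fun t => ?_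
      obtain ⟨i, hi⟩ := hno t
      filter_upwards [eventually_neg_of_not_posAt (hne w hw t i) hi] with ε hε
      exact ⟨i, by rwa [hadd]⟩
    obtain ⟨ε, h1, h2, h3⟩ := (hneg.and (hp.and (hw.eventually p))).exists
    obtain ⟨B, hB, l, hl, hsum⟩ := exists_isRegularCell hu hc h2 h3
    obtain ⟨i, hi⟩ := h1 ⟨B, hB⟩
    rw [← hsum, hrepr ⟨B, hB⟩] at hi
    exact absurd (hl _ (e ⟨B, hB⟩ i).2) (not_le.2 hi)
  · intro t t' ht ht'
    have h1 : ∀ᶠ ε in 𝓝[>] (0 : ℚ), ∀ i, 0 < (b t).repr (p + ε • w) i :=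
      eventually_all.2 fun i => by simpa only [hadd] using (ht i).eventually
    have h2 : ∀ᶠ ε in 𝓝[>] (0 : ℚ), ∀ i, 0 < (b t').repr (p + ε • w) i :=
      eventually_all.2 fun i => by simpa only [hadd] using (ht' i).eventually
    obtain ⟨ε, h1, h2⟩ := (h1.and h2).exists
    obtain ⟨l, hl⟩ := (hB t).exists_sum (p + ε • w)
    obtain ⟨l', hl'⟩ := (hB t').exists_sum (p + ε • w)
    rw [← hl] at h1
    rw [← hl'] at h2
    have hpos : ∀ i ∈ t.1, 0 < l i := fun i hi => by
      have := h1 ((e t).symm ⟨i, hi⟩)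
      rwa [hrepr, Equiv.apply_symm_apply] at this
    have hpos' : ∀ i ∈ t'.1, 0 < l' i := fun i hi => by
      have := h2 ((e t').symm ⟨i, hi⟩)
      rwa [hrepr, Equiv.apply_symm_apply] at this
    exact Subtype.ext (subset_antisymm (t'.2.subset t.2 hpos' hpos (hl'.trans hl.symm))
      (t.2.subset t'.2 hpos hpos' (hl.trans hl'.symm)))

end Triangulation

section Reciprocity

open Filter Topology

universe u

variable {ι : Type u} {E : Type*} [AddCommGroup E] [Module ℚ E]

/-- The generating function counting the elements of `S` by the value of `u`. -/
def gradedSeries (u : Module.Dual ℚ E) (S : Set E) : PowerSeries ℤ :=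
  PowerSeries.mk fun m => ({z ∈ S | u z = m}.ncard : ℤ)

/-- The lattice points of the half-open simplicial cone spanned by `b`, where the boundary
is included or not according to the direction `w`; the coordinates outside `A` are restricted
to a half-open unit interval. -/
def halfOpenCell {N : ℕ} (Λ : AddSubgroup E) (b : Module.Basis (Fin N) ℚ E) (w : E)
    (A : Finset (Fin N)) : Set E :=
  {z | z ∈ Λ ∧ ∀ i, PosAt (b.repr z i) (b.repr w i) ∧
    (i ∉ A → ¬PosAt (b.repr z i - 1) (b.repr w i))}

theorem PosAt.nonneg {a b : ℚ} (h : PosAt a b) : 0 ≤ a := by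
  rcases h with h | h
  exacts [h.le, h.1.ge]

theorem PosAt.of_sub_one {a b : ℚ} (h : PosAt (a - 1) b) : PosAt a b :=
  Or.inl (by linarith [h.nonneg])

section Cell

variable {N : ℕ} {Λ : AddSubgroup E} {b : Module.Basis (Fin N) ℚ E} {u : Module.Dual ℚ E}

theorem dual_apply_eq_sum_repr (hub : ∀ i, u (b i) = 1) (z : E) : u z = ∑ i, b.repr z i := by
  have h := congrArg u (b.sum_repr z)
  rw [← h, map_sum]
  exact Finset.sum_congr rfl fun i _ => by rw [map_smul, hub, smul_eq_mul, mul_one]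

theorem gradedSeries_halfOpenCell_insert (hb : ∀ i, b i ∈ Λ) (hub : ∀ i, u (b i) = 1) (w : E)
    (hfin : ∀ m : ℕ, {z | z ∈ Λ ∧ (∀ i, 0 ≤ b.repr z i) ∧ u z = m}.Finite)
    {A : Finset (Fin N)} {j : Fin N} (hj : j ∉ A) :
    gradedSeries u (halfOpenCell Λ b w (insert j A)) * (1 - PowerSeries.X) =
      gradedSeries u (halfOpenCell Λ b w A) := by
  have hsub : ∀ (A : Finset (Fin N)) (m : ℕ), {z ∈ halfOpenCell Λ b w A | u z = m}.Finite :=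
    fun A m => (hfin m).subset fun z hz => ⟨hz.1.1, fun i => (hz.1.2 i).1.nonneg, hz.2⟩
  have key : ∀ q : ℚ, {z ∈ halfOpenCell Λ b w (insert j A) | u z = q} =
      {z ∈ halfOpenCell Λ b w A | u z = q} ∪
        (fun z => z + b j) '' {z ∈ halfOpenCell Λ b w (insert j A) | u z = q - 1} := by
    intro q
    ext z
    constructor
    · rintro ⟨⟨hz, hzi⟩, hu⟩
      by_cases hzj : PosAt (b.repr z j - 1) (b.repr w j)
      · refine Or.inr ⟨z - b j, ⟨⟨Λ.sub_mem hz (hb j), fun i => ?_⟩, by simp [hu, hub]⟩, by simp⟩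
        by_cases hij : i = j
        · subst hij
          simpa using hzj
        · simpa [Finsupp.single_apply, Ne.symm hij] using hzi i
      · refine Or.inl ⟨⟨hz, fun i => ⟨(hzi i).1, fun hi => ?_⟩⟩, hu⟩
        by_cases hij : i = j
        · subst hij
          exact hzj
        · exact (hzi i).2 (by simp [hij, hi])
    · rintro (⟨⟨hz, hzi⟩, hu⟩ | ⟨z, ⟨⟨hz, hzi⟩, hu⟩, rfl⟩)
      · exact ⟨⟨hz, fun i => ⟨(hzi i).1, fun hi => (hzi i).2 fun h => hi (by simp [h])⟩⟩, hu⟩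
      · refine ⟨⟨Λ.add_mem hz (hb j), fun i => ?_⟩, by simp [hu, hub]⟩
        by_cases hij : i = j
        · subst hij
          refine ⟨PosAt.of_sub_one ?_, fun h => absurd (Finset.mem_insert_self _ _) h⟩
          simpa using (hzi i).1
        · simpa [Finsupp.single_apply, Ne.symm hij] using hzi i
  have hdisj : ∀ q : ℚ, Disjoint {z ∈ halfOpenCell Λ b w A | u z = q}
      ((fun z => z + b j) '' {z ∈ halfOpenCell Λ b w (insert j A) | u z = q - 1}) := by
    intro q
    rw [Set.disjoint_left]
    rintro _ h ⟨z, hz, rfl⟩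
    refine (h.1.2 j).2 hj ?_
    simpa using (hz.1.2 j).1
  ext m
  rw [mul_sub, mul_one, map_sub]
  rcases m with _ | m
  · rw [PowerSeries.coeff_zero_mul_X, sub_zero]
    simp only [gradedSeries, PowerSeries.coeff_mk]
    congr 2
    rw [key]
    have : {z ∈ halfOpenCell Λ b w (insert j A) | u z = ((0 : ℕ) : ℚ) - 1} = ∅ := by
      refine Set.eq_empty_of_forall_notMem fun z hz => ?_
      have h1 := hz.2
      rw [dual_apply_eq_sum_repr hub] at h1
      have h2 : 0 ≤ ∑ i, b.repr z i := Finset.sum_nonneg fun i _ => (hz.1.2 i).1.nonneg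
      rw [h1] at h2
      norm_num at h2
    rw [this, Set.image_empty, Set.union_empty]
  · rw [PowerSeries.coeff_succ_mul_X]
    simp only [gradedSeries, PowerSeries.coeff_mk]
    have hcast : ((m + 1 : ℕ) : ℚ) - 1 = m := by push_cast; ring
    have hd := hdisj (m + 1 : ℕ)
    rw [key, Set.ncard_union_eq hd (hsub _ _) ?_,
      Set.ncard_image_of_injective _ (add_left_injective (b j)), hcast]
    · push_cast; ring
    · rw [hcast]
      exact (hsub _ _).image _

theorem gradedSeries_halfOpenCell_mul (hb : ∀ i, b i ∈ Λ) (hub : ∀ i, u (b i) = 1) (w : E)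
    (hfin : ∀ m : ℕ, {z | z ∈ Λ ∧ (∀ i, 0 ≤ b.repr z i) ∧ u z = m}.Finite)
    (A : Finset (Fin N)) :
    gradedSeries u (halfOpenCell Λ b w A) * (1 - PowerSeries.X) ^ A.card =
      gradedSeries u (halfOpenCell Λ b w ∅) := by
  induction A using Finset.induction_on with
  | empty => simp
  | insert j A hj ih =>
    rw [Finset.card_insert_of_notMem hj, pow_succ', ← mul_assoc,
      gradedSeries_halfOpenCell_insert hb hub w hfin hj, ih]

theorem ncard_halfOpenCell_neg (hb : ∀ i, b i ∈ Λ) (hub : ∀ i, u (b i) = 1) {w : E}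
    (hw : ∀ i, b.repr w i ≠ 0) (q : ℚ) :
    {z ∈ halfOpenCell Λ b (-w) ∅ | u z = q}.ncard =
      {z ∈ halfOpenCell Λ b w ∅ | u z = N - q}.ncard := by
  have hrefl : ∀ (w : E), (∀ i, b.repr w i ≠ 0) → ∀ z q, z ∈ halfOpenCell Λ b w ∅ ∧ u z = N - q →
      ∑ i, b i - z ∈ halfOpenCell Λ b (-w) ∅ ∧ u (∑ i, b i - z) = q := by
    rintro w hw z q ⟨⟨hz, hzi⟩, hu⟩
    refine ⟨⟨Λ.sub_mem (Λ.sum_mem fun i _ => hb i) hz, fun i => ?_⟩, by simp [hub, hu]⟩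
    have h1 : b.repr (∑ i, b i - z) i = 1 - b.repr z i := by
      simp [Finsupp.single_apply]
    rw [h1]
    have h2 := hzi i
    have h3 := hw i
    simp only [map_neg, Finsupp.neg_apply, PosAt] at h2 ⊢
    grind
  rw [← Set.ncard_image_of_injective {z ∈ halfOpenCell Λ b w ∅ | u z = N - q}
    (sub_right_injective (b := ∑ i, b i))]
  congr 1
  ext z
  constructor
  · intro hz
    refine ⟨∑ i, b i - z, ?_, by simp⟩
    have := hrefl (-w) (by simpa using hw) z (N - q) (by simpa using hz)
    simpa using this
  · rintro ⟨y, hy, rfl⟩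
    exact hrefl w hw y q hy

theorem halfOpenCell_empty_bound (hub : ∀ i, u (b i) = 1) {w z : E}
    (hz : z ∈ halfOpenCell Λ b w ∅) : u z ≤ N := by
  rw [dual_apply_eq_sum_repr hub]
  calc ∑ i, b.repr z i ≤ ∑ _i : Fin N, (1 : ℚ) := Finset.sum_le_sum fun i _ => by
        have := (hz.2 i).2 (by simp)
        unfold PosAt at this
        push Not at this
        linarith [this.1]
    _ = N := by simp

end Cell

theorem add_mem_ratCone {v : ι → E} {s : Finset ι} {p q : E} (hp : p ∈ ratCone v s)
    (hq : q ∈ ratCone v s) : p + q ∈ ratCone v s := by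
  obtain ⟨l, hl, rfl⟩ := hp
  obtain ⟨m, hm, rfl⟩ := hq
  exact ⟨l + m, fun i hi => add_nonneg (hl i hi) (hm i hi), by
    simp [add_smul, Finset.sum_add_distrib]⟩

theorem smul_mem_ratCone {v : ι → E} {s : Finset ι} {p : E} (hp : p ∈ ratCone v s) {t : ℚ}
    (ht : 0 ≤ t) : t • p ∈ ratCone v s := by
  obtain ⟨l, hl, rfl⟩ := hp
  exact ⟨t • l, fun i hi => mul_nonneg ht (hl i hi), by simp [Finset.smul_sum, mul_smul]⟩

theorem zero_mem_ratCone (v : ι → E) (s : Finset ι) : 0 ∈ ratCone v s :=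
  ⟨0, by simp, by simp⟩

theorem mem_ratCone_of_mem (v : ι → E) {s : Finset ι} {i : ι} (hi : i ∈ s) :
    v i ∈ ratCone v s := by
  classical
  refine ⟨Pi.single i 1, fun j _ => ?_, by simp [Pi.single_apply, hi]⟩
  by_cases h : j = i
  · subst h; simp
  · simp [h]

/-- The lattice points that stay in the cone when moved slightly in the direction `w`. -/
def shiftedPoints [Fintype ι] (Λ : AddSubgroup E) (v : ι → E) (w : E) : Set E :=
  {z | z ∈ Λ ∧ ∀ᶠ ε in 𝓝[>] (0 : ℚ), z + ε • w ∈ ratCone v Finset.univ}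

theorem halfOpenCell_univ_subset [Fintype ι] {N : ℕ} {Λ : AddSubgroup E} {v : ι → E}
    {b : Module.Basis (Fin N) ℚ E} (hbv : ∀ i, ∃ j, b i = v j) (w : E) :
    halfOpenCell Λ b w Finset.univ ⊆ shiftedPoints Λ v w := by
  rintro z ⟨hz, hzi⟩
  refine ⟨hz, ?_⟩
  have : ∀ᶠ ε in 𝓝[>] (0 : ℚ), ∀ i, 0 < b.repr z i + ε * b.repr w i :=
    eventually_all.2 fun i => (hzi i).1.eventually
  filter_upwards [this] with ε hε
  rw [← b.sum_repr (z + ε • w)]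
  refine Finset.sum_induction _ (· ∈ ratCone v Finset.univ) (fun _ _ => add_mem_ratCone)
    (zero_mem_ratCone _ _) fun i _ => ?_
  obtain ⟨j, hj⟩ := hbv i
  rw [hj]
  exact smul_mem_ratCone (mem_ratCone_of_mem v (Finset.mem_univ j)) (by simpa using (hε i).le)

/-- **Ehrhart–Stanley reciprocity** for lattice points counted in a cone shifted in opposite
generic directions. -/
theorem coeff_gradedSeries_shiftedPoints_neg [Fintype ι] [FiniteDimensional ℚ E]
    {Λ : AddSubgroup E} {v : ι → E} {u : Module.Dual ℚ E} (hv : ∀ i, v i ∈ Λ)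
    (hu : ∀ i, u (v i) = 1)
    (hfin : ∀ m : ℕ, {z | z ∈ Λ ∧ z ∈ ratCone v Finset.univ ∧ u z = m}.Finite) {w : E}
    (hw : IsGenericFor v w) (k : ℕ) :
    PowerSeries.coeff k (gradedSeries u (shiftedPoints Λ v (-w)) *
        (1 - PowerSeries.X) ^ Module.finrank ℚ E) =
      if k ≤ Module.finrank ℚ E then
        PowerSeries.coeff (Module.finrank ℚ E - k) (gradedSeries u (shiftedPoints Λ v w) *
          (1 - PowerSeries.X) ^ Module.finrank ℚ E)
      else 0 := by
  obtain ⟨τ, _, b, hbv, htri⟩ := exists_triangulation v hu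
  have hb : ∀ t i, b t i ∈ Λ := fun t i => by
    obtain ⟨j, hj⟩ := hbv t i
    rw [hj]; exact hv j
  have hub : ∀ t i, u (b t i) = 1 := fun t i => by
    obtain ⟨j, hj⟩ := hbv t i
    rw [hj]; exact hu j
  have hfin' : ∀ t (m : ℕ), {z | z ∈ Λ ∧ (∀ i, 0 ≤ (b t).repr z i) ∧ u z = m}.Finite := by
    refine fun t m => (hfin m).subset fun z hz => ⟨hz.1, ?_, hz.2.2⟩
    rw [← (b t).sum_repr z]
    refine Finset.sum_induction _ (· ∈ ratCone v Finset.univ) (fun _ _ => add_mem_ratCone)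
      (zero_mem_ratCone _ _) fun i _ => ?_
    obtain ⟨j, hj⟩ := hbv t i
    rw [hj]
    exact smul_mem_ratCone (mem_ratCone_of_mem v (Finset.mem_univ j)) (hz.2.1 i)
  have hseries : ∀ w, IsGenericFor v w → gradedSeries u (shiftedPoints Λ v w) *
      (1 - PowerSeries.X) ^ Module.finrank ℚ E =
        ∑ t, gradedSeries u (halfOpenCell Λ (b t) w ∅) := by
    intro w hw
    have h1 : gradedSeries u (shiftedPoints Λ v w) =
        ∑ t, gradedSeries u (halfOpenCell Λ (b t) w Finset.univ) := by
      ext m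
      rw [map_sum]
      simp only [gradedSeries, PowerSeries.coeff_mk]
      rw [← Nat.cast_sum, ← finsum_eq_sum_of_fintype, ← Set.ncard_iUnion_of_finite]
      · congr 2
        ext z
        simp only [Set.mem_ofPred_eq, Set.mem_iUnion]
        constructor
        · rintro ⟨hz, hzu⟩
          obtain ⟨t, ht, -⟩ := (htri w hw).2 z hz.2
          exact ⟨t, ⟨hz.1, fun i => ⟨ht i, by simp⟩⟩, hzu⟩
        · rintro ⟨t, hz, hzu⟩
          exact ⟨halfOpenCell_univ_subset (hbv t) w hz, hzu⟩
      · exact fun t => (hfin' t m).subset fun z hz =>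
          ⟨hz.1.1, fun i => (hz.1.2 i).1.nonneg, hz.2⟩
      · intro t t' hne
        refine Set.disjoint_left.2 fun z hz hz' => hne ?_
        exact ((htri w hw).2 z (halfOpenCell_univ_subset (hbv t) w hz.1).2).unique
          (fun i => (hz.1.2 i).1) (fun i => (hz'.1.2 i).1)
    rw [h1, Finset.sum_mul]
    refine Finset.sum_congr rfl fun t _ => ?_
    simpa using gradedSeries_halfOpenCell_mul (hb t) (hub t) w (hfin' t) Finset.univ
  rw [hseries _ hw, hseries _ hw.neg, map_sum, map_sum]
  simp only [gradedSeries, PowerSeries.coeff_mk]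
  split_ifs with hk
  · refine Finset.sum_congr rfl fun t _ => ?_
    rw [ncard_halfOpenCell_neg (hb t) (hub t) ((htri w hw).1 t), Nat.cast_sub hk]
  · refine Finset.sum_eq_zero fun t _ => ?_
    have : {z ∈ halfOpenCell Λ (b t) (-w) ∅ | u z = k} = ∅ := by
      refine Set.eq_empty_of_forall_notMem fun z hz => hk ?_
      have := halfOpenCell_empty_bound (hub t) hz.1
      rw [hz.2] at this
      exact_mod_cast this
    rw [this, Set.ncard_empty, Nat.cast_zero]

end Reciprocity

section Gorenstein

open Filter Topology

universe u

variable {ι : Type u} {E : Type*} [AddCommGroup E] [Module ℚ E]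

theorem dual_nonneg_of_mem_ratCone {v : ι → E} {s : Finset ι} {y : Module.Dual ℚ E}
    (hy : ∀ i ∈ s, 0 ≤ y (v i)) {p : E} (hp : p ∈ ratCone v s) : 0 ≤ y p := by
  obtain ⟨l, hl, rfl⟩ := hp
  rw [map_sum]
  exact Finset.sum_nonneg fun i hi => by
    rw [map_smul, smul_eq_mul]
    exact mul_nonneg (hl i hi) (hy i hi)

theorem exists_irredundant_halfspaces [FiniteDimensional ℚ E] (v : ι → E) (s : Finset ι) :
    ∃ Y : Finset (Module.Dual ℚ E), (∀ p, p ∈ ratCone v s ↔ ∀ y ∈ Y, 0 ≤ y p) ∧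
      ∀ y ∈ Y, ∃ z, y z < 0 ∧ ∀ y' ∈ Y, y' ≠ y → 0 ≤ y' z := by
  classical
  obtain ⟨Y, hY, hmin⟩ := exists_minimal_of_wellFoundedLT
    (fun Y : Finset (Module.Dual ℚ E) => ∀ p, p ∈ ratCone v s ↔ ∀ y ∈ Y, 0 ≤ y p)
    (exists_halfspaces_ratCone v s)
  refine ⟨Y, hY, fun y hy => ?_⟩
  by_contra! h
  have hle := hmin (y := Y.erase y) (fun p => ?_) (Finset.erase_subset _ _)
  · exact absurd (hle hy) (Finset.notMem_erase _ _)
  · rw [hY]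
    refine ⟨fun h y' hy' => h y' (Finset.mem_of_mem_erase hy'), fun hp y' hy' => ?_⟩
    by_cases hyy : y' = y
    · subst hyy
      by_contra! hneg
      obtain ⟨y'', h1, h2, h3⟩ := h p hneg
      exact absurd (hp y'' (Finset.mem_erase.2 ⟨h2, h1⟩)) (not_le.2 h3)
    · exact hp y' (Finset.mem_erase.2 ⟨hyy, hy'⟩)

section Points

variable [Fintype ι] {Λ : AddSubgroup E} {v : ι → E} {Y : Finset (Module.Dual ℚ E)} {w : E}

theorem shiftedPoints_eq_of_mem (hY : ∀ p, p ∈ ratCone v Finset.univ ↔ ∀ y ∈ Y, 0 ≤ y p)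
    (hw : w ∈ ratCone v Finset.univ) :
    shiftedPoints Λ v w = {z | z ∈ Λ ∧ z ∈ ratCone v Finset.univ} := by
  ext z
  refine and_congr_right fun _ => ⟨fun h => (hY z).2 fun y hy => ?_, fun h => ?_⟩
  · by_contra! hneg
    have h1 : ¬PosAt (y z) (y w) := fun h => absurd h.nonneg (not_le.2 hneg)
    have h2 : ∀ᶠ ε in 𝓝[>] (0 : ℚ), 0 < -y z + ε * -y w := PosAt.eventually (Or.inl (by linarith))
    obtain ⟨ε, h3, h4⟩ := (h.and h2).exists
    have h5 := (hY _).1 h3 y hy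
    simp only [map_add, map_smul, smul_eq_mul] at h5
    linarith
  · filter_upwards [self_mem_nhdsWithin] with ε hε
    exact add_mem_ratCone h (smul_mem_ratCone hw (le_of_lt hε))

theorem shiftedPoints_neg_eq (hY : ∀ p, p ∈ ratCone v Finset.univ ↔ ∀ y ∈ Y, 0 ≤ y p)
    (hw : ∀ y ∈ Y, 0 < y w) :
    shiftedPoints Λ v (-w) = {z | z ∈ Λ ∧ ∀ y ∈ Y, 0 < y z} := by
  ext z
  refine and_congr_right fun _ => ⟨fun h y hy => ?_, fun h => ?_⟩
  · obtain ⟨ε, h1, hε⟩ := (h.and self_mem_nhdsWithin).exists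
    have hε : 0 < ε := hε
    have h2 := (hY _).1 h1 y hy
    simp only [map_add, map_smul, map_neg, smul_eq_mul] at h2
    nlinarith [mul_pos hε (hw y hy)]
  · have : ∀ᶠ ε in 𝓝[>] (0 : ℚ), ∀ y ∈ Y, 0 < y z + ε * y (-w) :=
      (Finset.eventually_all Y).2 fun y hy => PosAt.eventually (Or.inl (h y hy))
    filter_upwards [this] with ε hε
    refine (hY _).2 fun y hy => ?_
    simpa using (hε y hy).le

end Points

theorem eq_X_pow_mul_of_symmetric {F G : PowerSeries ℤ} {h : Polynomial ℤ} {N d : ℕ}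
    (hdN : d ≤ N) (hdeg : h.natDegree = d) (hsym : ∀ i ≤ d, h.coeff i = h.coeff (d - i))
    (hF : F * (1 - PowerSeries.X) ^ N = (h : PowerSeries ℤ))
    (hG : ∀ k, PowerSeries.coeff k (G * (1 - PowerSeries.X) ^ N) =
      if k ≤ N then PowerSeries.coeff (N - k) (F * (1 - PowerSeries.X) ^ N) else 0) :
    G = PowerSeries.X ^ (N - d) * F := by
  have hne : (1 - PowerSeries.X : PowerSeries ℤ) ^ N ≠ 0 := by
    refine pow_ne_zero _ fun h0 => ?_
    simpa using congrArg PowerSeries.constantCoeff h0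
  refine mul_right_cancel₀ hne ?_
  rw [mul_assoc, hF]
  ext k
  rw [hG, hF, PowerSeries.coeff_X_pow_mul']
  simp only [Polynomial.coeff_coe]
  have hz : ∀ i, d < i → h.coeff i = 0 := fun i hi =>
    Polynomial.coeff_eq_zero_of_natDegree_lt (hdeg ▸ hi)
  split_ifs with h1 h2 h2
  · rw [hsym _ (by omega)]
    congr 1
    omega
  · exact hz _ (by omega)
  · exact (hz _ (by omega)).symm
  · rfl

/-- The interior lattice points of a Gorenstein cone are the translates of its lattice points by
one of them. -/
theorem exists_gorenstein_point [Fintype ι] [FiniteDimensional ℚ E] {Λ : AddSubgroup E}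
    {v : ι → E} {u : Module.Dual ℚ E} {Y : Finset (Module.Dual ℚ E)} {w : E}
    (hv : ∀ i, v i ∈ Λ) (hu : ∀ i, u (v i) = 1) (huΛ : ∀ z ∈ Λ, ∃ k : ℤ, u z = k)
    (hfin : ∀ m : ℕ, {z | z ∈ Λ ∧ z ∈ ratCone v Finset.univ ∧ u z = m}.Finite)
    (hY : ∀ p, p ∈ ratCone v Finset.univ ↔ ∀ y ∈ Y, 0 ≤ y p)
    (hw : w ∈ ratCone v Finset.univ) (hwY : ∀ y ∈ Y, 0 < y w) (hgen : IsGenericFor v w)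
    {h : Polynomial ℤ} {d : ℕ} (hd : d ≤ Module.finrank ℚ E) (hdeg : h.natDegree = d)
    (hsym : ∀ i ≤ d, h.coeff i = h.coeff (d - i))
    (hser : gradedSeries u {z | z ∈ Λ ∧ z ∈ ratCone v Finset.univ} *
      (1 - PowerSeries.X) ^ Module.finrank ℚ E = (h : PowerSeries ℤ)) :
    ∃ x ∈ Λ, u x = (Module.finrank ℚ E - d : ℕ) ∧ (∀ y ∈ Y, 0 < y x) ∧
      ∀ z ∈ Λ, (∀ y ∈ Y, 0 < y z) → ∀ y ∈ Y, 0 ≤ y (z - x) := by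
  have hser' := eq_X_pow_mul_of_symmetric hd hdeg hsym hser fun k => by
    have := coeff_gradedSeries_shiftedPoints_neg hv hu hfin hgen k
    rwa [shiftedPoints_eq_of_mem hY hw] at this
  rw [shiftedPoints_neg_eq hY hwY] at hser'
  generalize Module.finrank ℚ E - d = r at hser'
  have hle : {z | z ∈ Λ ∧ ∀ y ∈ Y, 0 < y z} ⊆ {z | z ∈ Λ ∧ z ∈ ratCone v Finset.univ} :=
    fun z hz => ⟨hz.1, (hY z).2 fun y hy => (hz.2 y hy).le⟩
  have hfinL : ∀ m : ℕ, {z ∈ {z | z ∈ Λ ∧ z ∈ ratCone v Finset.univ} | u z = m}.Finite :=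
    fun m => (hfin m).subset fun z hz => ⟨hz.1.1, hz.1.2, hz.2⟩
  have hfinI : ∀ m : ℕ, {z ∈ {z | z ∈ Λ ∧ ∀ y ∈ Y, 0 < y z} | u z = m}.Finite :=
    fun m => (hfinL m).subset fun z hz => ⟨hle hz.1, hz.2⟩
  have hcoeff : ∀ k : ℕ, {z ∈ {z | z ∈ Λ ∧ ∀ y ∈ Y, 0 < y z} | u z = k}.ncard =
      if r ≤ k then {z ∈ {z | z ∈ Λ ∧ z ∈ ratCone v Finset.univ} | u z = (k - r : ℕ)}.ncard
      else 0 := by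
    intro k
    have := congrArg (PowerSeries.coeff k) hser'
    rw [PowerSeries.coeff_X_pow_mul'] at this
    simp only [gradedSeries, PowerSeries.coeff_mk] at this
    split_ifs at this ⊢ with hk <;> exact_mod_cast this
  have hx : {z ∈ {z | z ∈ Λ ∧ ∀ y ∈ Y, 0 < y z} | u z = r}.Nonempty := by
    rw [← Set.ncard_pos (hfinI r), hcoeff, if_pos le_rfl, Set.ncard_pos (hfinL _)]
    exact ⟨0, ⟨Λ.zero_mem, zero_mem_ratCone _ _⟩, by simp⟩
  obtain ⟨x, ⟨hx, hxY⟩, hxu⟩ := hx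
  refine ⟨x, hx, hxu, hxY, fun z hz hzY => ?_⟩
  obtain ⟨k, hk⟩ : ∃ k : ℕ, u z = k := by
    obtain ⟨k, hk⟩ := huΛ z hz
    have h0 : 0 ≤ u z := dual_nonneg_of_mem_ratCone (fun i _ => by rw [hu]; exact zero_le_one)
      (hle ⟨hz, hzY⟩).2
    rw [hk] at h0
    lift k to ℕ using by exact_mod_cast h0
    exact ⟨k, by exact_mod_cast hk⟩
  have hmem : z ∈ {z ∈ {z | z ∈ Λ ∧ ∀ y ∈ Y, 0 < y z} | u z = k} := ⟨⟨hz, hzY⟩, hk⟩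
  have hrk : r ≤ k := by
    by_contra hrk
    have h1 := hcoeff k
    rw [if_neg hrk, Set.ncard_eq_zero (hfinI k)] at h1
    rw [h1] at hmem
    exact hmem
  have himg : (fun p => x + p) '' {z ∈ {z | z ∈ Λ ∧ z ∈ ratCone v Finset.univ} |
      u z = (k - r : ℕ)} = {z ∈ {z | z ∈ Λ ∧ ∀ y ∈ Y, 0 < y z} | u z = k} := by
    refine Set.eq_of_subset_of_ncard_le ?_ ?_ (hfinI k)
    · rintro _ ⟨p, ⟨⟨hp, hpC⟩, hpu⟩, rfl⟩
      refine ⟨⟨Λ.add_mem hx hp, fun y hy => ?_⟩, ?_⟩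
      · rw [map_add]
        linarith [hxY y hy, (hY p).1 hpC y hy]
      · rw [map_add, hxu, hpu, Nat.cast_sub hrk]
        ring
    · rw [hcoeff, if_pos hrk, Set.ncard_image_of_injective _ (add_right_injective x)]
  rw [← himg] at hmem
  obtain ⟨p, ⟨⟨_, hpC⟩, _⟩, rfl⟩ := hmem
  simpa using (hY p).1 hpC

/-- The facet functionals of a Gorenstein cone, normalized to be `1` on the Gorenstein point,
are integral. -/
theorem exists_int_mul_of_gorenstein_point {Λ : AddSubgroup E} {Y : Finset (Module.Dual ℚ E)}
    {w x : E} (hdense : ∀ f : E, ∃ k : ℕ, 0 < k ∧ k • f ∈ Λ)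
    (hirr : ∀ y ∈ Y, ∃ z, y z < 0 ∧ ∀ y' ∈ Y, y' ≠ y → 0 ≤ y' z)
    (hwY : ∀ y ∈ Y, 0 < y w) (hx : x ∈ Λ) (hxY : ∀ y ∈ Y, 0 < y x)
    (hint : ∀ z ∈ Λ, (∀ y ∈ Y, 0 < y z) → ∀ y ∈ Y, 0 ≤ y (z - x))
    {y : Module.Dual ℚ E} (hy : y ∈ Y) {z : E} (hz : z ∈ Λ) : ∃ k : ℤ, y z = k * y x := by
  obtain ⟨f, hf, hyf, hYf⟩ : ∃ f ∈ Λ, y f = 0 ∧ ∀ y' ∈ Y, y' ≠ y → 0 < y' f := by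
    obtain ⟨p, hp, hpY⟩ := hirr y hy
    obtain ⟨k, hk, hkΛ⟩ := hdense (y w • p - y p • w)
    refine ⟨_, hkΛ, by simp [mul_comm], fun y' hy' hne => ?_⟩
    have h1 := hpY y' hy' hne
    have h2 := hwY y hy
    have h3 := hwY y' hy'
    have h4 : 0 < y w * y' p - y p * y' w := by nlinarith [mul_nonneg h2.le h1]
    have h5 : (0 : ℚ) < k := by exact_mod_cast hk
    simpa using mul_pos h5 h4
  have hxy := hxY y hy
  refine ⟨⌊y z / y x⌋, ?_⟩
  set k := ⌊y z / y x⌋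
  have hk1 : (k : ℚ) * y x ≤ y z := (le_div_iff₀ hxy).1 (Int.floor_le _)
  have hk2 : y z < (k + 1 : ℚ) * y x := (div_lt_iff₀ hxy).1 (Int.lt_floor_add_one _)
  by_contra hne
  have hpos : 0 < y (z - k • x) := by
    simp only [map_sub, map_zsmul, zsmul_eq_mul]
    exact sub_pos.2 (lt_of_le_of_ne hk1 (Ne.symm hne))
  have hM : ∀ᶠ M : ℕ in atTop, ∀ y' ∈ Y, 0 < y' (z - k • x + M • f) := by
    refine (Finset.eventually_all Y).2 fun y' hy' => ?_
    simp only [map_add _ (z - k • x), map_nsmul, nsmul_eq_mul]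
    by_cases hyy : y' = y
    · rw [hyy, hyf]
      simp only [mul_zero, add_zero]
      exact Eventually.of_forall fun _ => hpos
    · exact (tendsto_atTop_add_const_left _ _ (tendsto_natCast_atTop_atTop.atTop_mul_const
        (hYf y' hy' hyy))).eventually_gt_atTop 0
  obtain ⟨M, hM⟩ := hM.exists
  have h1 := hint _ (Λ.add_mem (Λ.sub_mem hz (Λ.zsmul_mem hx k)) (Λ.nsmul_mem hf M)) hM y hy
  simp only [map_add, map_sub, map_zsmul, map_nsmul, hyf, zsmul_eq_mul, smul_zero] at h1
  linarith

/-- A Gorenstein cone of degree `d` admits a decomposition of its grading into many nonzero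
nonnegative integral functionals. -/
theorem exists_functionals_of_symmetric [Fintype ι] [FiniteDimensional ℚ E] {Λ : AddSubgroup E}
    {v : ι → E} {u : Module.Dual ℚ E} (hspan : Submodule.span ℚ (Set.range v) = ⊤)
    (hdense : ∀ f : E, ∃ k : ℕ, 0 < k ∧ k • f ∈ Λ)
    (hv : ∀ i, v i ∈ Λ) (hu : ∀ i, u (v i) = 1) (huΛ : ∀ z ∈ Λ, ∃ k : ℤ, u z = k)
    (hfin : ∀ m : ℕ, {z | z ∈ Λ ∧ z ∈ ratCone v Finset.univ ∧ u z = m}.Finite)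
    {h : Polynomial ℤ} {d : ℕ} (hd : d < Module.finrank ℚ E) (hdeg : h.natDegree = d)
    (hsym : ∀ i ≤ d, h.coeff i = h.coeff (d - i))
    (hser : gradedSeries u {z | z ∈ Λ ∧ z ∈ ratCone v Finset.univ} *
      (1 - PowerSeries.X) ^ Module.finrank ℚ E = (h : PowerSeries ℤ)) :
    ∃ (s : ℕ) (c : Fin (s + 1) → Module.Dual ℚ E), (∀ j, c j ≠ 0) ∧
      (∀ j, ∀ z ∈ Λ, ∃ k : ℤ, c j z = k) ∧ (∀ j i, 0 ≤ c j (v i)) ∧ ∑ j, c j = u ∧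
      (Module.finrank ℚ E ≤ s + 2 * d ∨ Module.finrank ℚ E = s + 1 + d) := by
  classical
  obtain ⟨Y, hY, hirr⟩ := exists_irredundant_halfspaces v Finset.univ
  obtain ⟨w, hw, hgen, hwY⟩ := exists_isGenericFor hspan Y fun y hy h0 => by
    obtain ⟨z, hz, _⟩ := hirr y hy
    simp [h0] at hz
  replace hwY : ∀ y ∈ Y, 0 < y w := fun y hy =>
    lt_of_le_of_ne ((hY w).1 hw y hy) (hwY y hy).symm
  obtain ⟨x, hx, hxu, hxY, hint⟩ :=
    exists_gorenstein_point hv hu huΛ hfin hY hw hwY hgen hd.le hdeg hsym hser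
  let η : Module.Dual ℚ E → Module.Dual ℚ E := fun y => (y x)⁻¹ • y
  have hηx : ∀ y ∈ Y, η y x = 1 := fun y hy => by simp [η, (hxY y hy).ne']
  have hηΛ : ∀ y ∈ Y, ∀ z ∈ Λ, ∃ k : ℤ, η y z = k := fun y hy z hz => by
    obtain ⟨k, hk⟩ := exists_int_mul_of_gorenstein_point hdense hirr hwY hx hxY hint hy hz
    refine ⟨k, ?_⟩
    have := (hxY y hy).ne'
    simp only [η, LinearMap.smul_apply, smul_eq_mul, hk]
    field_simp
  have hηv : ∀ y ∈ Y, ∀ i, 0 ≤ η y (v i) := fun y hy i =>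
    mul_nonneg (inv_nonneg.2 (hxY y hy).le)
      ((hY _).1 (mem_ratCone_of_mem v (Finset.mem_univ i)) y hy)
  have huη : u ∈ ratCone η Y := by
    obtain ⟨l, hl, hlu⟩ := mem_ratCone_of_forall_nonneg Y u fun p hp =>
      dual_nonneg_of_mem_ratCone (fun i _ => by rw [hu]; exact zero_le_one) ((hY p).2 hp)
    refine ⟨fun y => l y * y x, fun y hy => mul_nonneg (hl y hy) (hxY y hy).le, ?_⟩
    rw [← hlu]
    refine Finset.sum_congr rfl fun y hy => ?_
    simp only [η, smul_smul, id]
    rw [mul_assoc, mul_inv_cancel₀ (hxY y hy).ne', mul_one]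
  obtain ⟨J, hJY, hJ, l, hl, hlu⟩ := exists_linearIndepOn_of_mem_ratCone η Y huη
  have hJcard : J.card ≤ Module.finrank ℚ E := by
    have := hJ.fintype_card_le_finrank
    rw [Subspace.dual_finrank_eq] at this
    simpa using this
  have hluz : ∀ z, ∑ y ∈ J, l y * η y z = u z := fun z => by simp [← hlu]
  let B : ℕ := ∑ y ∈ J, ⌊l y⌋₊
  have hBle : Module.finrank ℚ E ≤ B + 2 * d := by
    let y₀ : Module.Dual ℚ E := ∑ y ∈ J, (⌊l y⌋₊ + 1 : ℚ) • η y - u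
    have hy₀z : ∀ z, y₀ z = ∑ y ∈ J, (⌊l y⌋₊ + 1 - l y) * η y z := fun z => by
      simp [y₀, ← hluz, ← Finset.sum_sub_distrib, sub_mul]
    have hy₀v : ∀ i, 0 ≤ (y₀ - u) (v i) := fun i => by
      have hlt : ∀ y ∈ J, 0 < (⌊l y⌋₊ + 1 - l y : ℚ) := fun y _ =>
        sub_pos.2 (Nat.lt_floor_add_one _)
      have hnn : ∀ y ∈ J, 0 ≤ (⌊l y⌋₊ + 1 - l y : ℚ) * η y (v i) := fun y hy =>
        mul_nonneg (hlt y hy).le (hηv y (hJY hy) i)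
      have hpos : 0 < y₀ (v i) := by
        rw [hy₀z]
        refine lt_of_le_of_ne (Finset.sum_nonneg hnn) fun h0 => ?_
        have h1 := (Finset.sum_eq_zero_iff_of_nonneg hnn).1 h0.symm
        have h2 := hluz (v i)
        rw [hu, Finset.sum_eq_zero] at h2
        · exact zero_ne_one h2
        · intro y hy
          rw [(mul_eq_zero.1 (h1 y hy)).resolve_left (hlt y hy).ne', mul_zero]
      obtain ⟨k, hk⟩ : ∃ k : ℤ, y₀ (v i) = k := by
        choose! k hk using fun y (hy : y ∈ J) => hηΛ y (hJY hy) (v i) (hv i)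
        refine ⟨∑ y ∈ J, (⌊l y⌋₊ + 1) * k y - 1, ?_⟩
        simp only [y₀, LinearMap.sub_apply, LinearMap.sum_apply, LinearMap.smul_apply,
          smul_eq_mul, hu]
        push_cast
        rw [Finset.sum_congr rfl fun y hy => by rw [hk y hy]]
      rw [hk] at hpos
      have : (1 : ℚ) ≤ k := by exact_mod_cast (Int.cast_pos.1 hpos : 0 < k)
      rw [LinearMap.sub_apply, hu, hk]
      linarith
    have hx0 := dual_nonneg_of_mem_ratCone (fun i _ => hy₀v i)
      ((hY x).2 fun y hy => (hxY y hy).le)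
    have hx1 : (∑ y ∈ J, (⌊l y⌋₊ + 1 : ℚ) • η y) x = B + J.card := by
      simp only [LinearMap.sum_apply, LinearMap.smul_apply, smul_eq_mul]
      rw [Finset.sum_congr rfl fun y hy => by rw [hηx y (hJY hy), mul_one]]
      simp [B, Finset.sum_add_distrib]
    simp only [y₀, LinearMap.sub_apply, hx1, hxu] at hx0
    have hx2 : 2 * (Module.finrank ℚ E - d) ≤ B + J.card := by
      have : (2 * (Module.finrank ℚ E - d : ℕ) : ℚ) ≤ B + J.card := by linarith
      exact_mod_cast this
    omega
  let κ := Σ y : J, Fin ⌊l y⌋₊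
  have hκ : Fintype.card κ = B := by
    rw [Fintype.card_sigma]
    simp only [Fintype.card_fin]
    exact Finset.sum_coe_sort J fun y => ⌊l y⌋₊
  have hκsum : ∑ k : κ, η k.1 = ∑ y ∈ J, (⌊l y⌋₊ : ℚ) • η y := by
    rw [Fintype.sum_sigma, ← Finset.sum_coe_sort J]
    simp [Nat.cast_smul_eq_nsmul]
  have hηne : ∀ y ∈ Y, η y ≠ 0 := fun y hy h0 => by
    have := hηx y hy
    simp [h0] at this
  let ρ : Module.Dual ℚ E := u - ∑ k : κ, η k.1
  have hρ : ∀ z, ρ z = ∑ y ∈ J, (l y - ⌊l y⌋₊) * η y z := fun z => by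
    simp [ρ, hκsum, ← hluz, ← Finset.sum_sub_distrib, sub_mul]
  have hρv : ∀ i, 0 ≤ ρ (v i) := fun i => by
    rw [hρ]
    exact Finset.sum_nonneg fun y hy => mul_nonneg
      (sub_nonneg.2 (Nat.floor_le (hl y hy).le)) (hηv y (hJY hy) i)
  have hρΛ : ∀ z ∈ Λ, ∃ k : ℤ, ρ z = k := fun z hz => by
    obtain ⟨k₀, hk₀⟩ := huΛ z hz
    choose k hk using fun y : J => hηΛ y (hJY y.2) z hz
    exact ⟨k₀ - ∑ i : κ, k i.1, by simp [ρ, hk₀, hk]⟩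
  by_cases hρ0 : ρ = 0
  · have hB : Module.finrank ℚ E - d = B := by
      have h1 := congrArg (· x) hρ0
      simp only [ρ, LinearMap.sub_apply, LinearMap.sum_apply, LinearMap.zero_apply, hxu] at h1
      rw [Finset.sum_congr rfl fun k _ => hηx k.1 (hJY k.1.2)] at h1
      simp only [Finset.sum_const, Finset.card_univ, hκ, nsmul_eq_mul, mul_one] at h1
      exact_mod_cast sub_eq_zero.1 h1
    obtain ⟨s, hs⟩ : ∃ s, B = s + 1 := ⟨B - 1, by omega⟩
    let e : Fin (s + 1) ≃ κ := (Fintype.equivFinOfCardEq (hκ.trans hs)).symm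
    refine ⟨s, fun j => η (e j).1, fun j => hηne _ (hJY (e j).1.2),
      fun j => hηΛ _ (hJY (e j).1.2), fun j => hηv _ (hJY (e j).1.2), ?_, Or.inr (by omega)⟩
    rw [Equiv.sum_comp e fun k : κ => η k.1]
    exact (sub_eq_zero.1 hρ0).symm
  · let e : Fin (B + 1) ≃ Option κ := (Fintype.equivFinOfCardEq (by simp [hκ])).symm
    let c : Option κ → Module.Dual ℚ E := fun o => o.elim ρ fun k => η k.1
    have hc : ∀ Q : Module.Dual ℚ E → Prop, Q ρ → (∀ y ∈ Y, Q (η y)) → ∀ j, Q (c (e j)) := by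
      intro Q h1 h2 j
      rcases e j with _ | k
      exacts [h1, h2 _ (hJY k.1.2)]
    refine ⟨B, fun j => c (e j), hc (· ≠ 0) hρ0 hηne,
      hc (fun y => ∀ z ∈ Λ, ∃ k : ℤ, y z = k) hρΛ hηΛ, hc (fun y => ∀ i, 0 ≤ y (v i)) hρv hηv,
      ?_, Or.inl hBle⟩
    rw [Equiv.sum_comp e c, Fintype.sum_option]
    simp [c, ρ]

end Gorenstein

section Translation

universe u

variable {n : ℕ}

/-- The lattice `ℤ^n × ℤ` inside `ℚ^n × ℚ`. -/
def intPoints (n : ℕ) : AddSubgroup ((Fin n → ℚ) × ℚ) where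
  carrier := {z | (∀ j, ∃ k : ℤ, z.1 j = k) ∧ ∃ k : ℤ, z.2 = k}
  zero_mem' := ⟨fun _ => ⟨0, by simp⟩, 0, by simp⟩
  add_mem' := by
    rintro x y ⟨hx, kx, hkx⟩ ⟨hy, ky, hky⟩
    refine ⟨fun j => ?_, kx + ky, by simp [hkx, hky]⟩
    obtain ⟨k, hk⟩ := hx j
    obtain ⟨l, hl⟩ := hy j
    exact ⟨k + l, by simp [hk, hl]⟩
  neg_mem' := by
    rintro x ⟨hx, kx, hkx⟩
    refine ⟨fun j => ?_, -kx, by simp [hkx]⟩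
    obtain ⟨k, hk⟩ := hx j
    exact ⟨-k, by simp [hk]⟩

theorem exists_pos_nsmul_mem_intPoints (f : (Fin n → ℚ) × ℚ) :
    ∃ k : ℕ, 0 < k ∧ k • f ∈ intPoints n := by
  refine ⟨(∏ j, (f.1 j).den) * f.2.den,
    mul_pos (Finset.prod_pos fun j _ => (f.1 j).den_pos) f.2.den_pos, ?_⟩
  have key : ∀ (q : ℚ) (k : ℕ), q.den ∣ k → ∃ m : ℤ, (k : ℚ) * q = m := by
    rintro q _ ⟨l, rfl⟩
    refine ⟨l * q.num, ?_⟩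
    push_cast
    rw [← Rat.den_mul_eq_num]
    ring
  refine ⟨fun j => ?_, ?_⟩
  · rw [Prod.smul_fst, Pi.smul_apply, nsmul_eq_mul]
    exact key (f.1 j) ((∏ j, (f.1 j).den) * f.2.den)
      (Dvd.dvd.mul_right (Finset.dvd_prod_of_mem (fun j => (f.1 j).den) (Finset.mem_univ j)) _)
  · rw [Prod.smul_snd, nsmul_eq_mul]
    exact key f.2 ((∏ j, (f.1 j).den) * f.2.den) (dvd_mul_left _ _)

/-- The real linear form on `ℝ^n` with the same coefficients as a rational functional. -/
def realForm (y : Module.Dual ℚ ((Fin n → ℚ) × ℚ)) : (Fin n → ℝ) →ₗ[ℝ] ℝ :=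
  ∑ j, (y (Pi.single j 1, 0) : ℝ) • LinearMap.proj j

theorem dual_prod_apply (y : Module.Dual ℚ ((Fin n → ℚ) × ℚ)) (z : Fin n → ℚ) (t : ℚ) :
    y (z, t) = ∑ j, y (Pi.single j 1, 0) * z j + t * y (0, 1) := by
  have h : (z, t) = ∑ j, z j • ((Pi.single j 1, 0) : (Fin n → ℚ) × ℚ) + t • (0, 1) := by
    ext j
    · simp [Prod.fst_sum, Finset.sum_apply, Pi.single_apply]
    · simp [Prod.snd_sum]
  rw [h, map_add, map_sum, map_smul, smul_eq_mul]
  congr 1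
  exact Finset.sum_congr rfl fun j _ => by rw [map_smul, smul_eq_mul, mul_comm]

theorem cast_dual_prod_apply (y : Module.Dual ℚ ((Fin n → ℚ) × ℚ)) (z : Fin n → ℤ) (t : ℚ) :
    ((y (fun j => (z j : ℚ), t) : ℚ) : ℝ) =
      realForm y (fun j => (z j : ℝ)) + t * (y (0, 1) : ℝ) := by
  rw [dual_prod_apply]
  simp [realForm]

/-- The generators of the cone over a polytope with vertices `a i`. -/
def coneGen {ι : Type*} (a : ι → Fin n → ℤ) (i : ι) : (Fin n → ℚ) × ℚ :=
  (fun j => (a i j : ℚ), 1)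

/-- The convex hull of a family of integer points. -/
def intHull {ι : Type*} (a : ι → Fin n → ℤ) : Set (Fin n → ℝ) :=
  convexHull ℝ (Set.range fun i j => (a i j : ℝ))

variable {ι : Type u} {a : ι → Fin n → ℤ}

theorem span_coneGen_eq_top (hfull : affineSpan ℝ (intHull a) = ⊤) :
    Submodule.span ℚ (Set.range (coneGen a)) = ⊤ := by
  by_contra hne
  obtain ⟨y, hy0, hy⟩ := Submodule.exists_le_ker_of_lt_top _ (lt_top_iff_ne_top.2 hne)
  apply hy0
  have hya : ∀ i, realForm y (fun j => (a i j : ℝ)) + (y (0, 1) : ℝ) = 0 := fun i => by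
    have h1 : y (coneGen a i) = 0 := hy (Submodule.subset_span ⟨i, rfl⟩)
    have h2 := cast_dual_prod_apply y (a i) 1
    rw [show y (fun j => (a i j : ℚ), 1) = 0 from h1] at h2
    simpa using h2.symm
  have hall : ∀ p, realForm y p + (y (0, 1) : ℝ) = 0 := fun p => by
    have hp : p ∈ affineSpan ℝ (intHull a) := by rw [hfull]; trivial
    rw [intHull, affineSpan_convexHull] at hp
    refine affineSpan_induction (p := fun p => realForm y p + (y (0, 1) : ℝ) = 0) hp ?_ ?_
    · rintro _ ⟨i, rfl⟩
      exact hya i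
    · intro c p q r hp hq hr
      simp only [vsub_eq_sub, vadd_eq_add, map_add, map_smul, map_sub, smul_eq_mul]
      linear_combination c * hp - c * hq + hr
  have h0 : y (0, 1) = 0 := by
    have := hall 0
    rw [map_zero, zero_add] at this
    exact_mod_cast this
  have hj : ∀ j, y (Pi.single j 1, 0) = 0 := fun j => by
    have := hall (Pi.single j 1)
    rw [h0] at this
    simpa [realForm, Pi.single_apply] using this
  refine LinearMap.ext fun z => ?_
  rw [← Prod.mk.eta (p := z), dual_prod_apply]
  simp [h0, hj]

variable [Fintype ι]

theorem cast_mem_smul_intHull_iff [Nonempty ι] (m : ℕ) (z : Fin n → ℤ) :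
    (fun j => (z j : ℝ)) ∈ (m : ℝ) • intHull a ↔
      ((fun j => (z j : ℚ), (m : ℚ)) : (Fin n → ℚ) × ℚ) ∈ ratCone (coneGen a) Finset.univ := by
  constructor
  · rintro ⟨p, hp, hpz⟩
    obtain ⟨Y, hY⟩ := exists_halfspaces_ratCone (coneGen a) Finset.univ
    refine (hY _).2 fun y hy => ?_
    have h1 : intHull a ⊆ {p | -(y (0, 1) : ℝ) ≤ realForm y p} := by
      refine convexHull_min ?_ (convex_halfSpace_ge (realForm y).isLinear _)
      rintro _ ⟨i, rfl⟩
      have h2 := (hY _).1 (mem_ratCone_of_mem (coneGen a) (Finset.mem_univ i)) y hy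
      have h3 := cast_dual_prod_apply y (a i) 1
      have h4 : (0 : ℝ) ≤ (y (coneGen a i) : ℝ) := by exact_mod_cast h2
      rw [show coneGen a i = (fun j => (a i j : ℚ), 1) from rfl, h3] at h4
      rw [Set.mem_ofPred_eq]
      push_cast at h4
      linarith
    have h5 : -(y (0, 1) : ℝ) ≤ realForm y p := h1 hp
    have h6 := cast_dual_prod_apply y z m
    have h7 : (m : ℝ) • p = fun j => (z j : ℝ) := hpz
    rw [← h7, map_smul, smul_eq_mul] at h6
    have h8 : (0 : ℝ) ≤ (y (fun j => (z j : ℚ), (m : ℚ)) : ℝ) := by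
      rw [h6]
      push_cast
      nlinarith [(Nat.cast_nonneg m : (0 : ℝ) ≤ m)]
    exact_mod_cast h8
  · rintro ⟨l, hl, hlz⟩
    have hl1 : ∑ i, l i = m := by
      have := congrArg Prod.snd hlz
      simpa [coneGen, Prod.snd_sum] using this
    have hl2 : ∀ j, ∑ i, l i * a i j = z j := fun j => by
      have := congrFun (congrArg Prod.fst hlz) j
      simpa [coneGen, Prod.fst_sum, Finset.sum_apply] using this
    rcases Nat.eq_zero_or_pos m with rfl | hm
    · have h0 : ∀ i, l i = 0 := fun i =>
        (Finset.sum_eq_zero_iff_of_nonneg hl).1 (by simpa using hl1) i (Finset.mem_univ i)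
      have hz : z = 0 := funext fun j => by
        have := hl2 j
        simp only [h0, zero_mul, Finset.sum_const_zero] at this
        exact_mod_cast this.symm
      obtain ⟨i⟩ := ‹Nonempty ι›
      refine ⟨_, subset_convexHull ℝ _ ⟨i, rfl⟩, ?_⟩
      ext j
      simp [hz]
    · have hm' : (m : ℝ) ≠ 0 := by positivity
      have hl1' : ∑ i, (l i : ℝ) = m := by exact_mod_cast hl1
      have hl2' : ∀ j, ∑ i, (l i : ℝ) * a i j = z j := fun j => by exact_mod_cast hl2 j
      refine ⟨(m : ℝ)⁻¹ • fun j => (z j : ℝ), ?_, smul_inv_smul₀ hm' _⟩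
      refine mem_convexHull_of_exists_fintype (fun i => (m : ℝ)⁻¹ * l i)
        (fun i j => (a i j : ℝ)) (fun i => ?_) ?_ (fun i => ⟨i, rfl⟩) ?_
      · have : (0 : ℝ) ≤ l i := by exact_mod_cast hl i (Finset.mem_univ i)
        positivity
      · rw [← Finset.mul_sum, hl1', inv_mul_cancel₀ hm']
      · ext j
        simp only [Finset.sum_apply, Pi.smul_apply, smul_eq_mul, mul_assoc]
        rw [← Finset.mul_sum, hl2']

theorem setOf_intPoints_eq_image (m : ℕ) :
    {z ∈ {z | z ∈ intPoints n ∧ z ∈ ratCone (coneGen a) Finset.univ} |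
      (LinearMap.snd ℚ (Fin n → ℚ) ℚ) z = m} =
    (fun z : Fin n → ℤ => ((fun j => (z j : ℚ), (m : ℚ)) : (Fin n → ℚ) × ℚ)) ''
      {z | ((fun j => (z j : ℚ), (m : ℚ)) : (Fin n → ℚ) × ℚ) ∈
        ratCone (coneGen a) Finset.univ} := by
  ext ⟨z, t⟩
  constructor
  · rintro ⟨⟨⟨hz, -⟩, hc⟩, ht⟩
    have ht : t = m := ht
    subst ht
    choose k hk using hz
    have : z = fun j => (k j : ℚ) := funext hk
    subst this
    exact ⟨k, hc, rfl⟩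
  · rintro ⟨k, hk, h⟩
    rw [← h]
    exact ⟨⟨⟨fun j => ⟨k j, rfl⟩, m, by simp⟩, hk⟩, rfl⟩

theorem finite_setOf_cast_mem_ratCone (m : ℕ) :
    {z : Fin n → ℤ | ((fun j => (z j : ℚ), (m : ℚ)) : (Fin n → ℚ) × ℚ) ∈
        ratCone (coneGen a) Finset.univ}.Finite := by
  let M : Fin n → ℤ := fun j => ∑ i, |a i j|
  refine (Set.finite_Icc (fun j => -(m * M j)) (fun j => m * M j)).subset ?_
  rintro z ⟨l, hl, hlz⟩
  have hl1 : ∑ i, l i = m := by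
    have := congrArg Prod.snd hlz
    simpa [coneGen, Prod.snd_sum] using this
  have hl2 : ∀ j, ∑ i, l i * a i j = z j := fun j => by
    have := congrFun (congrArg Prod.fst hlz) j
    simpa [coneGen, Prod.fst_sum, Finset.sum_apply] using this
  have hb : ∀ j, |z j| ≤ m * M j := fun j => by
    have : |(z j : ℚ)| ≤ m * M j := by
      rw [← hl2, ← hl1, Finset.sum_mul]
      refine (Finset.abs_sum_le_sum_abs _ _).trans (Finset.sum_le_sum fun i hi => ?_)
      rw [abs_mul, abs_of_nonneg (hl i hi)]
      refine mul_le_mul_of_nonneg_left ?_ (hl i hi)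
      have : |a i j| ≤ M j :=
        Finset.single_le_sum (f := fun i => |a i j|) (fun _ _ => abs_nonneg _) hi
      exact_mod_cast this
    exact_mod_cast this
  exact ⟨fun j => (abs_le.1 (hb j)).1, fun j => (abs_le.1 (hb j)).2⟩

theorem gradedSeries_mul_of_isHStarPoly [Nonempty ι] {h : Polynomial ℤ}
    (hh : IsHStarPoly (intHull a) h) :
    gradedSeries (LinearMap.snd ℚ (Fin n → ℚ) ℚ)
      {z | z ∈ intPoints n ∧ z ∈ ratCone (coneGen a) Finset.univ} *
      (1 - PowerSeries.X) ^ (n + 1) = (h : PowerSeries ℤ) := by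
  have h1 : gradedSeries (LinearMap.snd ℚ (Fin n → ℚ) ℚ)
      {z | z ∈ intPoints n ∧ z ∈ ratCone (coneGen a) Finset.univ} =
      (h : PowerSeries ℤ) * (PowerSeries.mk 1) ^ (n + 1) := by
    ext m
    rw [gradedSeries, PowerSeries.coeff_mk, setOf_intPoints_eq_image,
      Set.ncard_image_of_injective _ fun x y hxy => ?_]
    · have h2 := hh.2.2 m
      simp only [latticePointCount, cast_mem_smul_intHull_iff] at h2
      rw [h2, PowerSeries.mk_one_pow_eq_mk_choose_add, PowerSeries.coeff_mul,
        Finset.Nat.sum_antidiagonal_eq_sum_range_succ_mk]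
      simp only [Polynomial.coeff_coe, PowerSeries.coeff_mk]
      have h3 : ∀ i, n < i → h.coeff i = 0 := fun i hi =>
        Polynomial.coeff_eq_zero_of_natDegree_lt (hh.1.trans_lt hi)
      let F : ℕ → ℤ := fun i => h.coeff i * ((n + m - i).choose n : ℤ)
      have hF1 : ∑ i ∈ Finset.range (n + 1), F i = ∑ i ∈ Finset.range (n + m + 1), F i :=
        Finset.sum_subset (Finset.range_subset_range.2 (by omega)) fun i _ hi => by
          simp only [F, h3 i (by simpa using hi), zero_mul]
      have hF2 : ∑ i ∈ Finset.range (m + 1), F i = ∑ i ∈ Finset.range (n + m + 1), F i :=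
        Finset.sum_subset (Finset.range_subset_range.2 (by omega)) fun i hi hi' => by
          simp only [Finset.mem_range] at hi hi'
          simp only [F, Nat.choose_eq_zero_of_lt (show n + m - i < n by omega), Nat.cast_zero,
            mul_zero]
      refine hF1.trans (hF2.symm.trans (Finset.sum_congr rfl fun i hi => ?_))
      rw [Finset.mem_range] at hi
      simp only [F, Nat.add_sub_assoc (show i ≤ m by omega)]
    · ext j
      exact Int.cast_injective (congrFun (congrArg Prod.fst hxy) j)
  rw [h1, mul_assoc, ← mul_pow, PowerSeries.mk_one_mul_one_sub_eq_one, one_pow, mul_one]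

/-- A Gorenstein polytope of small degree has many nonnegative integral affine functions adding
up to `1`. -/
theorem exists_affine_forms [Nonempty ι] (hfull : affineSpan ℝ (intHull a) = ⊤)
    {h : Polynomial ℤ} {d : ℕ} (hh : IsHStarPoly (intHull a) h) (hdeg : h.natDegree = d)
    (hsym : ∀ i ≤ d, h.coeff i = h.coeff (d - i)) :
    ∃ (s : ℕ) (b : Matrix (Fin (s + 1)) (Fin n) ℤ) (k : Fin (s + 1) → ℤ),
      (∀ j i, 0 ≤ (b.mulVec (a i) + k) j) ∧ (∀ i, ∑ j, (b.mulVec (a i) + k) j = 1) ∧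
      (∀ j, ∃ i, (b.mulVec (a i) + k) j ≠ 0) ∧ (n + 1 ≤ s + 2 * d ∨ n + 1 = s + 1 + d) := by
  have hN : Module.finrank ℚ ((Fin n → ℚ) × ℚ) = n + 1 := by simp
  have hspan := span_coneGen_eq_top hfull
  obtain ⟨s, c, hc0, hcΛ, hcv, hcu, hs⟩ := exists_functionals_of_symmetric (h := h) (d := d)
    hspan exists_pos_nsmul_mem_intPoints
    (u := LinearMap.snd ℚ (Fin n → ℚ) ℚ)
    (fun i => ⟨fun j => ⟨a i j, rfl⟩, 1, by simp [coneGen]⟩) (fun i => rfl)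
    (fun z hz => hz.2) (fun m => by
      have := (finite_setOf_cast_mem_ratCone (a := a) m).image
        (fun z : Fin n → ℤ => ((fun j => (z j : ℚ), (m : ℚ)) : (Fin n → ℚ) × ℚ))
      rw [← setOf_intPoints_eq_image] at this
      exact this.subset fun z hz => ⟨⟨hz.1, hz.2.1⟩, hz.2.2⟩)
    (by rw [hN]; exact Nat.lt_succ_of_le (hdeg ▸ hh.1)) hdeg hsym
    (by rw [hN]; exact gradedSeries_mul_of_isHStarPoly hh)
  rw [hN] at hs
  choose b hb using fun (j : Fin (s + 1)) (l : Fin n) => hcΛ j (Pi.single l 1, 0)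
    ⟨fun i => by
      by_cases h : i = l
      · subst h; exact ⟨1, by simp⟩
      · exact ⟨0, by simp [h]⟩, 0, by simp⟩
  choose k hk using fun j => hcΛ j (0, 1) ⟨fun i => ⟨0, by simp⟩, 1, by simp⟩
  have key : ∀ j i, c j (coneGen a i) = (((Matrix.of b).mulVec (a i) + k) j : ℤ) := fun j i => by
    rw [coneGen, dual_prod_apply]
    simp [hb, hk, Matrix.mulVec, dotProduct]
  refine ⟨s, Matrix.of b, k, fun j i => ?_, fun i => ?_, fun j => ?_, hs⟩
  · have := hcv j i
    rw [key] at this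
    exact_mod_cast this
  · have : ∑ j, c j (coneGen a i) = 1 := by
      rw [← LinearMap.sum_apply, hcu]
      rfl
    simp only [key] at this
    exact_mod_cast this
  · by_contra! h0
    refine hc0 j (LinearMap.ext_on_range hspan fun i => ?_)
    rw [key, h0]
    simp

end Translation

section LatticeChange

/-- An integer vector, viewed as a real one. -/
def intVec {m : ℕ} (z : Fin m → ℤ) : Fin m → ℝ := fun i => (z i : ℝ)

theorem isLatticePoint_iff_exists_intVec {m : ℕ} {v : Fin m → ℝ} :
    IsLatticePoint v ↔ ∃ z, intVec z = v := by
  constructor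
  · intro h
    choose z hz using h
    exact ⟨z, funext fun i => (hz i).symm⟩
  · rintro ⟨z, rfl⟩ i
    exact ⟨z i, rfl⟩

theorem intVec_add {m : ℕ} (z z' : Fin m → ℤ) : intVec (z + z') = intVec z + intVec z' := by
  ext i
  simp [intVec]

/-- The real extension of an integral linear map. -/
def realExt {m p : ℕ} (f : (Fin m → ℤ) →ₗ[ℤ] (Fin p → ℤ)) : (Fin m → ℝ) →ₗ[ℝ] (Fin p → ℝ) :=
  Matrix.toLin' ((LinearMap.toMatrix' f).map (Int.cast : ℤ → ℝ))

theorem realExt_intVec {m p : ℕ} (f : (Fin m → ℤ) →ₗ[ℤ] (Fin p → ℤ)) (z : Fin m → ℤ) :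
    realExt f (intVec z) = intVec (f z) := by
  ext i
  rw [realExt, Matrix.toLin'_apply, intVec, ← LinearMap.toMatrix'_mulVec f z]
  simp [Matrix.mulVec, dotProduct, intVec]

theorem linearMap_ext_intVec {m : ℕ} {M : Type*} [AddCommGroup M] [Module ℝ M]
    {F G : (Fin m → ℝ) →ₗ[ℝ] M} (h : ∀ z : Fin m → ℤ, F (intVec z) = G (intVec z)) : F = G := by
  refine (Pi.basisFun ℝ (Fin m)).ext fun i => ?_
  have : intVec (Pi.single i 1) = Pi.basisFun ℝ (Fin m) i := by
    ext j
    simp [intVec, Pi.single_apply]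
  rw [← this, h]

/-- A surjective integral linear map is a coordinate projection in a suitable lattice basis. -/
theorem exists_linearEquiv_snd_eq {n s : ℕ} (L : (Fin n → ℤ) →ₗ[ℤ] (Fin s → ℤ))
    (hL : Function.Surjective L) : ∃ (q : ℕ) (e : (Fin n → ℤ) ≃ₗ[ℤ] (Fin q → ℤ) × (Fin s → ℤ)),
      q + s = n ∧ ∀ z, (e z).2 = L z := by
  obtain ⟨g, hg⟩ := Module.projective_lifting_property L LinearMap.id hL
  have hg' : ∀ t, L (g t) = t := fun t => LinearMap.congr_fun hg t
  let e₁ : (Fin n → ℤ) ≃ₗ[ℤ] LinearMap.ker L × (Fin s → ℤ) :=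
    LinearEquiv.ofLinearMap
      ((LinearMap.codRestrict (LinearMap.ker L) (LinearMap.id - g ∘ₗ L) fun z => by
        simp [hg']).prod L)
      ((LinearMap.ker L).subtype.coprod g)
      (by
        refine LinearMap.ext fun ⟨p, t⟩ => ?_
        have hp : L p = 0 := p.2
        ext <;> simp [hg', hp])
      (by
        refine LinearMap.ext fun z => ?_
        simp)
  let e : (Fin n → ℤ) ≃ₗ[ℤ] (Fin (Module.finrank ℤ (LinearMap.ker L)) → ℤ) × (Fin s → ℤ) :=
    e₁.trans ((Module.finBasis ℤ (LinearMap.ker L)).equivFun.prodCongr (LinearEquiv.refl ℤ _))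
  exact ⟨_, e, by simpa using e.finrank_eq.symm, fun z => rfl⟩

/-- A lattice isomorphism followed by a lattice translation is a lattice equivalence. -/
theorem exists_isLatticeEquiv {n q s : ℕ} (e : (Fin n → ℤ) ≃ₗ[ℤ] (Fin q → ℤ) × (Fin s → ℤ))
    (k : Fin s → ℤ) : ∃ T : (Fin n → ℝ) ≃ᵃ[ℝ] (Fin q → ℝ) × (Fin s → ℝ), IsLatticeEquiv T ∧
      ∀ z, T (intVec z) = (intVec (e z).1, intVec ((e z).2 + k)) := by
  let f₁ := realExt (LinearMap.fst ℤ _ _ ∘ₗ e.toLinearMap)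
  let f₂ := realExt (LinearMap.snd ℤ _ _ ∘ₗ e.toLinearMap)
  let g₁ := realExt (e.symm.toLinearMap ∘ₗ LinearMap.inl ℤ _ _)
  let g₂ := realExt (e.symm.toLinearMap ∘ₗ LinearMap.inr ℤ _ _)
  have hf : ∀ z, (f₁.prod f₂) (intVec z) = (intVec (e z).1, intVec (e z).2) := fun z => by
    simp [f₁, f₂, realExt_intVec]
  have hg : ∀ p t, (g₁.coprod g₂) (intVec p, intVec t) = intVec (e.symm (p, t)) := fun p t => by
    simp only [LinearMap.coprod_apply, g₁, g₂, realExt_intVec, ← intVec_add]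
    simp [← map_add]
  have h0 : ∀ m : ℕ, (0 : Fin m → ℝ) = intVec 0 := fun m => by ext i; simp [intVec]
  have hfg : (f₁.prod f₂) ∘ₗ (g₁.coprod g₂) = LinearMap.id := by
    refine LinearMap.prod_ext (linearMap_ext_intVec fun p => ?_)
      (linearMap_ext_intVec fun t => ?_)
    · rw [LinearMap.comp_apply, LinearMap.comp_apply, LinearMap.inl_apply, h0 s, hg, hf]
      simp [h0 s]
    · rw [LinearMap.comp_apply, LinearMap.comp_apply, LinearMap.inr_apply, h0 q, hg, hf]
      simp [h0 q]
  have hgf : (g₁.coprod g₂) ∘ₗ (f₁.prod f₂) = LinearMap.id :=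
    linearMap_ext_intVec fun z => by rw [LinearMap.comp_apply, hf, hg]; simp
  let R : (Fin n → ℝ) ≃ₗ[ℝ] (Fin q → ℝ) × (Fin s → ℝ) :=
    LinearEquiv.ofLinearMap (f₁.prod f₂) (g₁.coprod g₂) hfg hgf
  let T : (Fin n → ℝ) ≃ᵃ[ℝ] (Fin q → ℝ) × (Fin s → ℝ) :=
    R.toAffineEquiv.trans (AffineEquiv.constVAdd ℝ _ (0, intVec k))
  have hT : ∀ z, T (intVec z) = (intVec (e z).1, intVec ((e z).2 + k)) := fun z => by
    have : T (intVec z) = (0, intVec k) + (f₁.prod f₂) (intVec z) := rfl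
    rw [this, hf, intVec_add]
    simp [add_comm]
  refine ⟨T, fun v => ⟨fun hv => ?_, fun hv => ?_⟩, hT⟩
  · obtain ⟨z, rfl⟩ := isLatticePoint_iff_exists_intVec.1 hv
    rw [hT]
    exact ⟨isLatticePoint_iff_exists_intVec.2 ⟨_, rfl⟩,
      isLatticePoint_iff_exists_intVec.2 ⟨_, rfl⟩⟩
  · obtain ⟨p, hp⟩ := isLatticePoint_iff_exists_intVec.1 hv.1
    obtain ⟨t, ht⟩ := isLatticePoint_iff_exists_intVec.1 hv.2
    refine isLatticePoint_iff_exists_intVec.2 ⟨e.symm (p, t - k), T.injective ?_⟩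
    rw [hT]
    refine Prod.ext ?_ ?_ <;> simp [hp, ht]

theorem cayleySum_convexHull {q s : ℕ} {ι : Type*} (p : ι → Fin q → ℝ) (c : ι → Fin (s + 1)) :
    CayleySum (fun j => convexHull ℝ (p '' {i | c i = j})) =
      convexHull ℝ (Set.range fun i => (p i, cayleyVertex s (c i))) := by
  refine (convexHull_min ?_ (convex_convexHull ℝ _)).antisymm (convexHull_mono ?_)
  · refine Set.iUnion_subset fun j => Set.image_subset_iff.2 (convexHull_min ?_ ?_)
    · rintro _ ⟨i, rfl, rfl⟩
      exact subset_convexHull ℝ _ ⟨i, rfl⟩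
    · intro x hx y hy α β hα hβ hαβ
      have := convex_convexHull ℝ _ hx hy hα hβ hαβ
      simpa [← add_smul, hαβ] using this
  · rintro _ ⟨i, rfl⟩
    exact Set.mem_iUnion.2 ⟨c i, p i, subset_convexHull ℝ _ ⟨i, rfl, rfl⟩, rfl⟩

theorem exists_eq_single_of_sum_eq_one {m : ℕ} {f : Fin m → ℤ} (hf : ∀ j, 0 ≤ f j)
    (hsum : ∑ j, f j = 1) : ∃ j, f = Pi.single j 1 := by
  obtain ⟨j, -, hj⟩ := Finset.exists_ne_zero_of_sum_ne_zero (hsum.trans_ne one_ne_zero)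
  rw [← Finset.add_sum_erase _ _ (Finset.mem_univ j)] at hsum
  have hrest : 0 ≤ ∑ i ∈ Finset.univ.erase j, f i := Finset.sum_nonneg fun i _ => hf i
  have hj' : 1 ≤ f j := by have := hf j; omega
  have hz : ∑ i ∈ Finset.univ.erase j, f i = 0 := by omega
  refine ⟨j, funext fun i => ?_⟩
  by_cases hij : i = j
  · subst hij
    rw [Pi.single_eq_same]
    omega
  · rw [Pi.single_eq_of_ne hij]
    exact (Finset.sum_eq_zero_iff_of_nonneg fun i _ => hf i).1 hz i (by simp [hij])

/-- A lattice polytope with nonnegative integral affine functions adding up to `1`, none of them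
vanishing identically, is a Cayley sum. -/
theorem exists_cayley_of_affine_forms {n s : ℕ} {ι : Type*} [Fintype ι] {a : ι → Fin n → ℤ}
    {b : Matrix (Fin (s + 1)) (Fin n) ℤ} {k : Fin (s + 1) → ℤ}
    (hnonneg : ∀ j i, 0 ≤ (b.mulVec (a i) + k) j) (hsum : ∀ i, ∑ j, (b.mulVec (a i) + k) j = 1)
    (hne : ∀ j, ∃ i, (b.mulVec (a i) + k) j ≠ 0) :
    ∃ q, q + s = n ∧ ∃ (Ps : Fin (s + 1) → Set (Fin q → ℝ))
        (T : (Fin n → ℝ) ≃ᵃ[ℝ] (Fin q → ℝ) × (Fin s → ℝ)),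
        (∀ j, IsLatticePolytope (Ps j)) ∧ IsLatticeEquiv T ∧ T '' intHull a = CayleySum Ps := by
  classical
  choose c hc using fun i => exists_eq_single_of_sum_eq_one (fun j => hnonneg j i) (hsum i)
  have hcsurj : ∀ j, ∃ i, c i = j := fun j => by
    obtain ⟨i, hi⟩ := hne j
    refine ⟨i, ?_⟩
    by_contra h
    rw [hc, Pi.single_eq_of_ne (Ne.symm h)] at hi
    exact hi rfl
  let L : (Fin n → ℤ) →ₗ[ℤ] (Fin s → ℤ) := (b.submatrix Fin.succ id).mulVecLin
  have hLc : ∀ i j, L (a i) j + k j.succ = (Pi.single (c i) 1 : Fin (s + 1) → ℤ) j.succ :=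
    fun i j => congrFun (hc i) j.succ
  have hL : Function.Surjective L := by
    rw [← LinearMap.range_eq_top, eq_top_iff, ← (Pi.basisFun ℤ (Fin s)).span_eq,
      Submodule.span_le]
    rintro _ ⟨j, rfl⟩
    obtain ⟨i, hi⟩ := hcsurj j.succ
    obtain ⟨i', hi'⟩ := hcsurj 0
    refine ⟨a i - a i', funext fun l => ?_⟩
    have h1 := hLc i l
    have h2 := hLc i' l
    rw [hi, Pi.single_apply] at h1
    rw [hi', Pi.single_eq_of_ne (Fin.succ_ne_zero l)] at h2
    simp only [map_sub, Pi.sub_apply, Pi.basisFun_apply, Pi.single_apply, Fin.succ_inj] at h1 ⊢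
    omega
  obtain ⟨q, e, hq, he⟩ := exists_linearEquiv_snd_eq L hL
  obtain ⟨T, hT, hTa⟩ := exists_isLatticeEquiv e fun j => k j.succ
  refine ⟨q, hq, fun j => convexHull ℝ ((fun i => intVec (e (a i)).1) '' {i | c i = j}), T,
    fun j => ?_, hT, ?_⟩
  · refine ⟨(Finset.univ.filter fun i => c i = j).image fun i => intVec (e (a i)).1, ?_, ?_, ?_⟩
    · obtain ⟨i, hi⟩ := hcsurj j
      exact ⟨_, Finset.mem_image_of_mem _ (Finset.mem_filter.2 ⟨Finset.mem_univ i, hi⟩)⟩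
    · intro v hv
      obtain ⟨i, -, rfl⟩ := Finset.mem_image.1 hv
      exact isLatticePoint_iff_exists_intVec.2 ⟨_, rfl⟩
    · simp
  · rw [cayleySum_convexHull, intHull]
    have := T.toAffineMap.image_convexHull (Set.range fun i j => (a i j : ℝ))
    refine this.trans ?_
    rw [← Set.range_comp]
    congr 2
    ext1 i
    refine (hTa (a i)).trans (Prod.ext rfl (funext fun j => ?_))
    have h1 := hLc i j
    rw [← he, Pi.single_apply] at h1
    simp only [intVec, Pi.add_apply, h1, cayleyVertex, Fin.ext_iff, Fin.val_succ]
    split_ifs <;> simp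

end LatticeChange

/-- A lattice polytope is the convex hull of a nonempty finite family of integer vectors. -/
theorem IsLatticePolytope.exists_eq_intHull {n : ℕ} {P : Set (Fin n → ℝ)}
    (hP : IsLatticePolytope P) : ∃ (ι : Type) (_ : Fintype ι) (_ : Nonempty ι)
      (a : ι → Fin n → ℤ), P = intHull a := by
  obtain ⟨V, ⟨v, hv⟩, hV, rfl⟩ := hP
  choose a ha using fun v : V => hV v v.2
  refine ⟨V, inferInstance, ⟨⟨v, hv⟩⟩, a, ?_⟩
  rw [intHull]
  congr 1
  have : (fun (i : V) j => (a i j : ℝ)) = Subtype.val := by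
    ext i j
    exact (ha i j).symm
  rw [this]
  simp

/-- (Theorem 3.1 / `gorst`.) Every `n`-dimensional Gorenstein polytope
of degree `d` (i.e. a lattice polytope whose `h^*`-polynomial is symmetric,
`h^*_i = h^*_{d−i}`) decomposes as a Cayley sum of lattice polytopes in `ℝ^q` for some
`q ≤ 2d − 1`, under a `ℤ`-affine linear change of coordinates `ℝ^n ≅ ℝ^q × ℝ^s` with
`q + s = n`. -/
theorem statement12 (n d : ℕ) (P : Set (Fin n → ℝ)) (h : Polynomial ℤ)
    (hP : IsLatticePolytope P) (hfull : affineSpan ℝ P = ⊤)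
    (hh : IsHStarPoly P h) (hdeg : h.natDegree = d)
    (hsym : ∀ i ≤ d, h.coeff i = h.coeff (d - i)) :
    ∃ q s : ℕ, q + s = n ∧ q ≤ 2 * d - 1 ∧
      ∃ (Ps : Fin (s + 1) → Set (Fin q → ℝ))
        (T : (Fin n → ℝ) ≃ᵃ[ℝ] (Fin q → ℝ) × (Fin s → ℝ)),
        (∀ j, IsLatticePolytope (Ps j)) ∧ IsLatticeEquiv T ∧ T '' P = CayleySum Ps := by
  obtain ⟨ι, _, _, a, rfl⟩ := hP.exists_eq_intHull
  obtain ⟨s, b, k, hnonneg, hsum, hne, hs⟩ := exists_affine_forms hfull hh hdeg hsym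
  obtain ⟨q, hq, hex⟩ := exists_cayley_of_affine_forms hnonneg hsum hne
  exact ⟨q, s, hq, by omega, hex⟩

end
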